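/- For every ε > 0 there exists a constant C = C(ε) > 0 such that the following holds. Let q be a prime, a an integer coprime to q, and M, N real numbers with 1 ≤ M ≤ q and 1 ≤ N ≤ q. Let 𝒩 ⊆ ℝ be an interval of length N, let α : ℕ → ℂ vanish outside the integers in [1, M], and let β : ℤ → ℂ vanish outside the integers lying in 𝒩. Then |Σ_m Σ_n α_m β_n Kl(a·m·n; q)| ≤ C · (qMN)^ε · (MN)^(1/2) · ‖α‖₂ · ‖β‖₂ · (M^(−1/2) + q^(1/4) N^(−1/2)). -/

import Mathlib

open scoped BigOperators

/-- The additive character `e_q(x) = e(x̃/q)` on `ZMod q`. -/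
noncomputable def eChar (q : ℕ) (x : ZMod q) : ℂ :=
  Complex.exp (2 * (Real.pi : ℂ) * Complex.I * (x.val : ℂ) / (q : ℂ))

/-- The normalized Kloosterman sum `Kl(x;q) = q^{-1/2} ∑_{d ∈ (ZMod q)ˣ} e_q(x d + d⁻¹)`. -/
noncomputable def Kl (q : ℕ) [NeZero q] (x : ZMod q) : ℂ :=
  ((Real.sqrt q)⁻¹ : ℝ) *
    ∑ d : (ZMod q)ˣ, eChar q (x * (d : ZMod q) + ((d⁻¹ : (ZMod q)ˣ) : ZMod q))

/-- `ℓ¹`-norm of a (finitely supported) sequence of complex numbers. -/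
noncomputable def l1norm {ι : Type*} (f : ι → ℂ) : ℝ := ∑' i, ‖f i‖

/-- `ℓ²`-norm of a (finitely supported) sequence of complex numbers. -/
noncomputable def l2norm {ι : Type*} (f : ι → ℂ) : ℝ := Real.sqrt (∑' i, ‖f i‖ ^ 2)

open Polynomial in
lemma stp_descent {K : Type*} [Field K] (f : K[X]) (hsq : Squarefree f) (hdeg : 0 < f.natDegree)
    (κ : K) (n : ℕ) : ∀ A D : K[X], A.natDegree ≤ n → A ^ 2 = C κ * D ^ 2 * f → κ ≠ 0 →
      A = 0 ∧ D = 0 := by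
  have hf0 : f ≠ 0 := by rintro rfl; simp at hdeg
  induction n using Nat.strong_induction_on with
  | _ n ih =>
    intro A D hA h hκ
    by_cases hA0 : A = 0
    · subst hA0
      refine ⟨rfl, ?_⟩
      have : C κ * D ^ 2 * f = 0 := by rw [← h]; simp
      simpa [hf0, hκ] using this
    exfalso
    have h1 : f ∣ A := by
      have : f ∣ A ^ 2 := by rw [h]; exact Dvd.intro_left _ rfl
      exact (hsq.dvd_pow_iff_dvd (by norm_num)).1 this
    obtain ⟨A', rfl⟩ := h1
    have h2 : f * A' ^ 2 = C κ * D ^ 2 := by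
      apply mul_left_cancel₀ hf0
      linear_combination h
    have h3 : f ∣ D := by
      have : f ∣ D ^ 2 := by
        have h4 : D ^ 2 = f * (C κ⁻¹ * A' ^ 2) := by
          have : C κ⁻¹ * C κ = (1 : K[X]) := by rw [← C_mul, inv_mul_cancel₀ hκ, C_1]
          linear_combination (-C κ⁻¹) * h2 - D ^ 2 * this
        exact ⟨_, h4⟩
      exact (hsq.dvd_pow_iff_dvd (by norm_num)).1 this
    obtain ⟨D', rfl⟩ := h3
    have h5 : A' ^ 2 = C κ * D' ^ 2 * f := by
      apply mul_left_cancel₀ hf0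
      linear_combination h2
    have hA'0 : A' ≠ 0 := right_ne_zero_of_mul hA0
    have hd : (f * A').natDegree = f.natDegree + A'.natDegree := natDegree_mul hf0 hA'0
    exact hA'0 (ih A'.natDegree (by omega) A' D' le_rfl h5 hκ).1

open Polynomial in
/-- Nonvanishing of the auxiliary polynomial. -/
lemma stp_nonvanish {K : Type*} [Field K] (p : ℕ) [Fact p.Prime] [CharP K p] (μ : ℕ)
    (hodd : Odd (p ^ μ))
    (f : K[X]) (hsq : Squarefree f) (hdeg : 0 < f.natDegree) (hf0 : f.eval 0 ≠ 0) (L : ℕ)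
    (hL : 2 * L + f.natDegree < p ^ μ) (I : ℕ)
    (A D : ℕ → K[X]) (hA : ∀ i, (A i).natDegree ≤ L) (hD : ∀ i, (D i).natDegree ≤ L)
    (h : ∑ i ∈ Finset.range I, X ^ (i * p ^ μ) * (A i + D i * f ^ ((p ^ μ + 1) / 2)) = 0) :
    ∀ i < I, A i = 0 ∧ D i = 0 := by
  set P := p ^ μ with hP
  have hhalf : (P + 1) / 2 * 2 = P + 1 := by
    obtain ⟨k, hk⟩ := hodd
    omega
  intro k
  induction k using Nat.strong_induction_on with
  | _ k ih =>
    intro hk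
    set g := f ^ ((P + 1) / 2) with hg
    have hg2 : g ^ 2 = f ^ P * f := by rw [hg, ← pow_mul, hhalf, pow_succ]
    -- split the sum
    have hs : ∀ B : ℕ → K[X], (∀ i < k, B i = 0) → ∃ B' : K[X],
        ∑ i ∈ Finset.range I, X ^ (i * P) * B i = X ^ (k * P) * (B k + X ^ P * B') := by
      intro B hB
      refine ⟨∑ i ∈ Finset.Ico (k + 1) I, X ^ ((i - k - 1) * P) * B i, ?_⟩
      rw [← Finset.sum_range_add_sum_Ico _ (show k + 1 ≤ I by omega), Finset.sum_range_succ,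
        Finset.sum_eq_zero (fun i hi => by rw [hB i (Finset.mem_range.1 hi), mul_zero]), zero_add,
        mul_add, Finset.mul_sum, Finset.mul_sum]
      congr 1
      apply Finset.sum_congr rfl
      intro i hi
      rw [Finset.mem_Ico] at hi
      obtain ⟨j, rfl⟩ : ∃ j, i = k + 1 + j := ⟨i - (k + 1), by omega⟩
      have : k + 1 + j - k - 1 = j := by omega
      rw [this, ← mul_assoc, ← mul_assoc, ← pow_add, ← pow_add]
      congr 2
      ring
    obtain ⟨A', hA'⟩ := hs A (fun i hi => (ih i hi (by omega)).1)
    obtain ⟨D', hD'⟩ := hs D (fun i hi => (ih i hi (by omega)).2)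
    have h1 : X ^ (k * P) * ((A k + X ^ P * A') + (D k + X ^ P * D') * g) = 0 := by
      rw [← h]
      simp only [mul_add, ← mul_assoc, Finset.sum_add_distrib, ← Finset.sum_mul]
      rw [hA', hD']
      ring
    have h2 : (A k + X ^ P * A') + (D k + X ^ P * D') * g = 0 := by
      rcases mul_eq_zero.1 h1 with h | h
      · exact absurd h (pow_ne_zero _ X_ne_zero)
      · exact h
    have h3 : (A k + X ^ P * A') ^ 2 = (D k + X ^ P * D') ^ 2 * (f ^ P * f) := by
      rw [← hg2]
      linear_combination (A k + X ^ P * A' - (D k + X ^ P * D') * g) * h2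
    obtain ⟨f', hf'⟩ : ∃ f' : K[X], f ^ P = C ((f.eval 0) ^ P) + X ^ P * f' := by
      have : X ∣ f - C (f.eval 0) := by
        rw [X_dvd_iff]; simp [coeff_zero_eq_eval_zero]
      obtain ⟨r, hr⟩ := this
      refine ⟨r ^ P, ?_⟩
      have h5 : f = C (f.eval 0) + X * r := by rw [← hr]; ring
      conv_lhs => rw [h5]
      rw [hP, add_pow_char_pow, mul_pow, C_pow]
    have h6 : X ^ P ∣ A k ^ 2 - C ((f.eval 0) ^ P) * D k ^ 2 * f := by
      rw [hf'] at h3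
      refine ⟨- (2 * A k * A' + X ^ P * A' ^ 2) + (2 * D k * D' + X ^ P * D' ^ 2) *
        (C ((f.eval 0) ^ P) + X ^ P * f') * f + D k ^ 2 * f' * f, ?_⟩
      linear_combination h3
    have h7 : A k ^ 2 - C ((f.eval 0) ^ P) * D k ^ 2 * f = 0 := by
      by_contra hne
      have h8 := natDegree_le_of_dvd h6 hne
      rw [natDegree_X_pow] at h8
      have h9 : (A k ^ 2 - C ((f.eval 0) ^ P) * D k ^ 2 * f).natDegree ≤ 2 * L + f.natDegree := by
        refine (natDegree_sub_le _ _).trans (max_le ?_ ?_)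
        · refine natDegree_pow_le.trans ?_
          have := hA k
          omega
        · refine natDegree_mul_le.trans ?_
          have h10 : (C (eval 0 f ^ P) * D k ^ 2).natDegree ≤ 2 * L := by
            refine (natDegree_C_mul_le _ _).trans (natDegree_pow_le.trans ?_)
            have := hD k
            omega
          omega
      omega
    exact stp_descent f hsq hdeg _ _ (A k) (D k) le_rfl (sub_eq_zero.1 h7) (pow_ne_zero _ hf0)

open Polynomial in
/-- Stepanov/Bombieri bound. -/
lemma stp_bound {K : Type*} [Field K] [Fintype K] [DecidableEq K] (p : ℕ) [Fact p.Prime]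
    [CharP K p] (μ : ℕ)
    (hcard : Fintype.card K = (p ^ μ) ^ 2) (hodd : Odd (p ^ μ))
    (f : K[X]) (hsq : Squarefree f) (d : ℕ) (hd : 0 < d) (hdeg : f.natDegree = 2 * d)
    (hf0 : f.eval 0 ≠ 0) (hbig : 2 * d ^ 2 + 2 * d < p ^ μ) (s : K) :
    2 * (Finset.univ.filter (fun y : K => (f.eval y) ^ (((p ^ μ) ^ 2 - 1) / 2) = s)).card
      ≤ (p ^ μ) ^ 2 + 6 * d * p ^ μ := by
  have hdeg0 : 0 < f.natDegree := by omega
  set P := p ^ μ with hP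
  obtain ⟨k, hk⟩ := hodd
  -- L = k + 1 - d, I = k + 1 + d
  have hkd : d ≤ k := by nlinarith
  obtain ⟨l, rfl⟩ : ∃ l, k = d + l := ⟨k - d, by omega⟩
  set I := d + l + 1 + d with hI
  set L := l + 1 with hLdef
  set g := f ^ ((P + 1) / 2) with hg
  have hhalf : (P + 1) / 2 = d + l + 1 := by omega
  have hgdeg : g.natDegree ≤ (d + l + 1) * (2 * d) := by
    rw [hg, hhalf, ← hdeg]; exact natDegree_pow_le
  let pol : (Fin L → K) → K[X] := fun c => ∑ j : Fin L, C (c j) * X ^ (j : ℕ)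
  have pol_sub : ∀ c c', pol (c - c') = pol c - pol c' := by
    intro c c'
    simp [pol, sub_mul, Finset.sum_sub_distrib]
  have pol_deg : ∀ c, (pol c).natDegree ≤ l := by
    intro c
    apply natDegree_sum_le_of_forall_le
    intro j _
    refine (natDegree_C_mul_X_pow_le _ _).trans ?_
    have := j.2
    omega
  have pol_inj : ∀ c, pol c = 0 → c = 0 := by
    intro c hc
    funext j
    have := congrArg (fun q : K[X] => q.coeff j) hc
    simp only [pol, finset_sum_coeff, coeff_C_mul, coeff_X_pow, coeff_zero] at this
    rw [Finset.sum_eq_single j] at this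
    · simpa using this
    · intro i _ hij
      rw [if_neg, mul_zero]
      intro h
      exact hij (Fin.ext h.symm)
    · simp
  let Φ : (Fin I → (Fin L → K) × (Fin L → K)) → K[X] := fun c =>
    ∑ i : Fin I, X ^ (i : ℕ) * ((pol (c i).1) ^ P + C s * (pol (c i).2) ^ P * g)
  set M := I + P * l + (d + l + 1) * (2 * d) with hM
  have Φ_deg : ∀ c, Φ c ∈ degreeLT K M := by
    intro c
    rw [mem_degreeLT]
    refine lt_of_le_of_lt (degree_le_natDegree) ?_
    rw [Nat.cast_lt]
    have hMpos : M = (M - 1) + 1 := by omega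
    rw [hMpos, Nat.lt_succ_iff]
    apply natDegree_sum_le_of_forall_le
    intro i _
    refine natDegree_mul_le.trans ?_
    rw [natDegree_X_pow]
    have h1 : ∀ c, ((pol c) ^ P).natDegree ≤ P * l := fun c =>
      natDegree_pow_le.trans (Nat.mul_le_mul_left _ (pol_deg c))
    have h2 : ((pol (c i).1) ^ P + C s * (pol (c i).2) ^ P * g).natDegree
        ≤ P * l + (d + l + 1) * (2 * d) := by
      refine (natDegree_add_le _ _).trans (max_le ((h1 _).trans (Nat.le_add_right _ _)) ?_)
      refine natDegree_mul_le.trans (Nat.add_le_add ?_ hgdeg)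
      exact (natDegree_C_mul_le _ _).trans (h1 _)
    have := i.2
    omega
  have hcount : M < I * (L + L) := by
    have : P = 2 * (d + l) + 1 := hk
    rw [hM, hI, hLdef, this]
    rw [this] at hbig
    nlinarith
  -- pigeonhole
  obtain ⟨c, hc0, hcΦ⟩ : ∃ c, c ≠ 0 ∧ Φ c = 0 := by
    let Ψ : (Fin I → (Fin L → K) × (Fin L → K)) → (Fin M → K) := fun c => fun j => (Φ c).coeff j
    have hni : ¬ Function.Injective Ψ := by
      intro hinj
      have := Fintype.card_le_of_injective Ψ hinj
      simp only [Fintype.card_fun, Fintype.card_prod, Fintype.card_fin] at this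
      rw [← pow_add, ← pow_mul] at this
      have h1 : 1 < Fintype.card K := Fintype.one_lt_card
      have := (Nat.pow_le_pow_iff_right h1).1 this
      rw [mul_comm] at this
      omega
    simp only [Function.Injective, not_forall] at hni
    obtain ⟨c, c', hcc, hne⟩ := hni
    refine ⟨c - c', sub_ne_zero.2 hne, ?_⟩
    have hsub : Φ (c - c') = Φ c - Φ c' := by
      simp only [Φ, ← Finset.sum_sub_distrib]
      apply Finset.sum_congr rfl
      intro i _
      simp only [Pi.sub_apply, Prod.fst_sub, Prod.snd_sub, pol_sub, hP, sub_pow_char_pow]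
      ring
    rw [hsub, sub_eq_zero]
    ext j
    by_cases hj : j < M
    · exact congrFun hcc ⟨j, hj⟩
    · have h1 : ∀ c, (Φ c).coeff j = 0 := by
        intro c
        have := Φ_deg c
        rw [mem_degreeLT] at this
        apply coeff_eq_zero_of_degree_lt
        refine this.trans_le ?_
        exact_mod_cast not_lt.1 hj
      rw [h1, h1]
  let A : ℕ → K[X] := fun i => if h : i < I then pol (c ⟨i, h⟩).1 else 0
  let D : ℕ → K[X] := fun i => if h : i < I then pol (c ⟨i, h⟩).2 else 0
  have hA : ∀ i, (A i).natDegree ≤ l := by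
    intro i
    simp only [A]
    split_ifs
    · exact pol_deg _
    · simp
  have hD : ∀ i, (D i).natDegree ≤ l := by
    intro i
    simp only [D]
    split_ifs
    · exact pol_deg _
    · simp
  set H : K[X] := ∑ i ∈ Finset.range I, X ^ (i * P) * (A i + D i * g) with hH
  have hH0 : H ≠ 0 := by
    intro h
    have := stp_nonvanish p μ ⟨_, hk⟩ f hsq hdeg0 hf0 l (by omega) I A D hA hD h
    apply hc0
    funext i
    have h1 := this i i.2
    simp only [A, D, i.2, dif_pos] at h1
    exact Prod.ext (pol_inj _ h1.1) (pol_inj _ h1.2)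
  have hΦ' : ∑ i ∈ Finset.range I, X ^ i * (A i ^ P + C s * D i ^ P * g) = 0 := by
    rw [← hcΦ, Finset.sum_range]
    simp [Φ, A, D]
  have hHdeg : H.natDegree ≤ (d + l + d) * P + (l + (d + l + 1) * (2 * d)) := by
    apply natDegree_sum_le_of_forall_le
    intro i hi
    rw [Finset.mem_range] at hi
    refine natDegree_mul_le.trans (Nat.add_le_add ?_ ?_)
    · rw [natDegree_X_pow]
      exact Nat.mul_le_mul_right _ (by omega)
    · refine (natDegree_add_le _ _).trans (max_le ((hA i).trans (Nat.le_add_right _ _)) ?_)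
      exact natDegree_mul_le.trans (Nat.add_le_add (hD i) hgdeg)
  have hroots : ∀ y : K, (f.eval y) ^ ((P ^ 2 - 1) / 2) = s → H.eval y = 0 := by
    intro y hy
    have hy2 : y ^ (P * P) = y := by
      have := FiniteField.pow_card y
      rwa [hcard, pow_two] at this
    have hPpos : P ≠ 0 := by omega
    have hexp : (P + 1) / 2 * P = (P ^ 2 - 1) / 2 + (P + 1) / 2 := by
      rw [hhalf]
      have : P ^ 2 - 1 = 2 * (2 * (d+l) * (d+l) + 2 * (d+l)) := by
        rw [hk, Nat.sub_eq_iff_eq_add (Nat.one_le_pow _ _ (by omega))]; ring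
      rw [this, Nat.mul_div_cancel_left _ (by norm_num), hk]
      ring
    have h1 : (H.eval y) ^ P = 0 := by
      rw [hH, eval_finset_sum, hP, sum_pow_char_pow, ← hP]
      have h2 := congrArg (eval y) hΦ'
      rw [eval_finset_sum, eval_zero] at h2
      rw [← h2]
      apply Finset.sum_congr rfl
      intro i _
      simp only [eval_mul, eval_pow, eval_X, eval_add, eval_C, hg]
      rw [mul_pow, hP, add_pow_char_pow, ← hP, mul_pow, ← pow_mul, ← pow_mul, mul_assoc i,
        mul_comm i, pow_mul, hy2, hexp, pow_add, hy]
      ring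
    exact pow_eq_zero_iff hPpos |>.1 h1
  have hcardle : (Finset.univ.filter (fun y : K => (f.eval y) ^ ((P ^ 2 - 1) / 2) = s)).card
      ≤ H.natDegree := by
    apply card_le_degree_of_subset_roots
    intro y hy
    simp only [Finset.filter_val, Multiset.mem_filter, Finset.mem_val, Finset.mem_univ,
      true_and] at hy
    rw [mem_roots hH0]
    exact hroots y hy
  have : P = 2 * (d + l) + 1 := hk
  rw [this] at hHdeg ⊢
  rw [this] at hcardle
  nlinarith

section KloostermanL
open Polynomial Finset

variable {p : ℕ} [Fact p.Prime]

/-- The multiplicative function on monic polynomials attached to a Kloosterman sum. -/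
noncomputable def etaK (ψ : AddChar (ZMod p) ℂ) (b : ZMod p) (h : (ZMod p)[X]) : ℂ :=
  if h.coeff 0 = 0 then 0 else ψ (-h.nextCoeff - b * (h.coeff 1 / h.coeff 0))

lemma etaK_mul (ψ : AddChar (ZMod p) ℂ) (b : ZMod p) (h g : (ZMod p)[X]) (hh : h.Monic)
    (hg : g.Monic) : etaK ψ b (h * g) = etaK ψ b h * etaK ψ b g := by
  unfold etaK
  rw [mul_coeff_zero, mul_coeff_one, hh.nextCoeff_mul hg]
  by_cases h0 : h.coeff 0 = 0
  · simp [h0]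
  by_cases g0 : g.coeff 0 = 0
  · simp [g0]
  rw [if_neg (mul_ne_zero h0 g0), if_neg h0, if_neg g0, ← AddChar.map_add_eq_mul]
  congr 1
  field_simp
  ring

lemma etaK_one (ψ : AddChar (ZMod p) ℂ) (b : ZMod p) : etaK ψ b 1 = 1 := by
  have : (1 : (ZMod p)[X]).coeff 1 = 0 := by rw [coeff_one]; simp
  have h2 : (1 : (ZMod p)[X]).nextCoeff = 0 := by simp [nextCoeff]
  simp [etaK, this, h2]

lemma etaK_pow (ψ : AddChar (ZMod p) ℂ) (b : ZMod p) (h : (ZMod p)[X]) (hh : h.Monic) (j : ℕ) :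
    etaK ψ b (h ^ j) = etaK ψ b h ^ j := by
  induction j with
  | zero => simp [etaK_one]
  | succ j ih => rw [pow_succ, etaK_mul _ _ _ _ (hh.pow j) hh, ih, pow_succ]

lemma monics_finite (p : ℕ) [Fact p.Prime] (n : ℕ) :
    {h : (ZMod p)[X] | h.Monic ∧ h.natDegree = n}.Finite := by
  apply Set.Finite.subset (Set.finite_range
    (fun c : Fin (n + 1) → ZMod p => ∑ i : Fin (n + 1), C (c i) * X ^ (i : ℕ)))
  rintro h ⟨_, hn⟩
  refine ⟨fun i => h.coeff i, ?_⟩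
  show ∑ i : Fin (n + 1), C (h.coeff i) * X ^ (i : ℕ) = h
  rw [← Finset.sum_range (fun i => C (h.coeff i) * X ^ i), ← as_sum_range_C_mul_X_pow' h (by omega)]

/-- Monic polynomials of degree `n` over `ZMod p`. -/
noncomputable def monics (p : ℕ) [Fact p.Prime] (n : ℕ) : Finset (ZMod p)[X] :=
  (monics_finite p n).toFinset

lemma mem_monics (n : ℕ) (h : (ZMod p)[X]) : h ∈ monics p n ↔ h.Monic ∧ h.natDegree = n := by
  simp [monics]

/-- Coefficients of the Kloosterman L-function. -/
noncomputable def SK (ψ : AddChar (ZMod p) ℂ) (b : ZMod p) (n : ℕ) : ℂ :=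
  ∑ h ∈ monics p n, etaK ψ b h

lemma SK_zero (ψ : AddChar (ZMod p) ℂ) (b : ZMod p) : SK ψ b 0 = 1 := by
  have : monics p 0 = {1} := by
    ext h
    rw [mem_monics, mem_singleton]
    constructor
    · rintro ⟨h1, h2⟩
      exact eq_one_of_monic_natDegree_zero h1 h2
    · rintro rfl
      simp
  rw [SK, this, sum_singleton, etaK_one]

lemma SK_large (ψ : AddChar (ZMod p) ℂ) (hψ : ψ ≠ 1) (b : ZMod p) (n : ℕ) (hn : 3 ≤ n) :
    SK ψ b n = 0 := by
  obtain ⟨t, ht⟩ : ∃ t, ψ (-t) ≠ 1 := by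
    obtain ⟨t, ht⟩ := AddChar.ne_one_iff.1 hψ
    exact ⟨-t, by simpa using ht⟩
  have hmem : ∀ t : ZMod p, ∀ h ∈ monics p n, h + C t * X ^ (n - 1) ∈ monics p n := by
    intro t h hh
    rw [mem_monics] at hh ⊢
    have hlt : (C t * X ^ (n - 1)).degree < h.degree := by
      rw [degree_eq_natDegree hh.1.ne_zero, hh.2]
      refine (degree_C_mul_X_pow_le _ _).trans_lt ?_
      exact_mod_cast (by omega : n - 1 < n)
    refine ⟨hh.1.add_of_left hlt, ?_⟩
    rw [natDegree_add_eq_left_of_degree_lt hlt, hh.2]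
  have heta : ∀ h ∈ monics p n, etaK ψ b (h + C t * X ^ (n - 1)) = etaK ψ b h * ψ (-t) := by
    intro h hh
    have h1 := (mem_monics _ _).1 hh
    have h2 := (mem_monics _ _).1 (hmem t h hh)
    have e0 : (h + C t * X ^ (n - 1)).coeff 0 = h.coeff 0 := by
      rw [coeff_add, coeff_C_mul_X_pow, if_neg (by omega), add_zero]
    have e1 : (h + C t * X ^ (n - 1)).coeff 1 = h.coeff 1 := by
      rw [coeff_add, coeff_C_mul_X_pow, if_neg (by omega), add_zero]
    have e2 : (h + C t * X ^ (n - 1)).nextCoeff = h.nextCoeff + t := by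
      rw [nextCoeff_of_natDegree_pos (by omega), nextCoeff_of_natDegree_pos (by omega), h2.2, h1.2,
        coeff_add, coeff_C_mul_X_pow, if_pos rfl]
    unfold etaK
    rw [e0, e1, e2]
    split_ifs
    · simp
    · rw [← AddChar.map_add_eq_mul]
      congr 1
      ring
  have key : SK ψ b n = SK ψ b n * ψ (-t) := by
    conv_lhs => rw [SK]
    rw [SK, Finset.sum_mul]
    symm
    refine Finset.sum_bij' (fun h _ => h + C t * X ^ (n - 1))
      (fun h _ => h + C (-t) * X ^ (n - 1)) ?_ ?_ ?_ ?_ ?_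
    · intro h hh; exact hmem t h hh
    · intro h hh; exact hmem (-t) h hh
    · intro h _; simp
    · intro h _; simp
    · intro h hh; rw [heta h hh]
  have : SK ψ b n * (1 - ψ (-t)) = 0 := by rw [mul_sub, mul_one, ← key, sub_self]
  rcases mul_eq_zero.1 this with h | h
  · exact h
  · exact absurd (sub_eq_zero.1 h).symm ht

lemma SK_two (ψ : AddChar (ZMod p) ℂ) (hψ : ψ ≠ 1) (b : ZMod p) (hb : b ≠ 0) :
    SK ψ b 2 = p := by
  have hbij : SK ψ b 2 = ∑ c : ZMod p × ZMod p,
      (if c.2 = 0 then 0 else ψ (-c.1 - b * (c.1 / c.2))) := by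
    rw [SK]
    have hq : ∀ c d : ZMod p, (X ^ 2 + C c * X + C d : (ZMod p)[X]).natDegree = 2 := by
      intro c d
      compute_degree!
    have hm : ∀ c d : ZMod p, (X ^ 2 + C c * X + C d : (ZMod p)[X]).Monic := by
      intro c d
      monicity!
    symm
    refine Finset.sum_bij' (fun c _ => (X ^ 2 + C c.1 * X + C c.2 : (ZMod p)[X]))
      (fun h _ => (h.coeff 1, h.coeff 0)) ?_ ?_ ?_ ?_ ?_
    · intro c _
      rw [mem_monics]
      exact ⟨hm _ _, hq _ _⟩
    · intro h _; exact mem_univ _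
    · rintro ⟨c, d⟩ _
      simp [coeff_X, coeff_C]
    · intro h hh
      rw [mem_monics] at hh
      have h2 : h.coeff 2 = 1 := by rw [← hh.2]; exact hh.1
      conv_rhs => rw [h.as_sum_range_C_mul_X_pow' (show h.natDegree < 3 by omega)]
      simp [Finset.sum_range_succ, h2]
      ring
    · rintro ⟨c, d⟩ _
      unfold etaK
      rw [nextCoeff_of_natDegree_pos (by rw [hq]; norm_num), hq]
      simp [coeff_X, coeff_C]
  rw [hbij, Fintype.sum_prod_type_right]
  have : ∀ d : ZMod p, (∑ c : ZMod p, if d = 0 then (0:ℂ) else ψ (-c - b * (c / d)))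
      = if d = -b then (p : ℂ) else 0 := by
    intro d
    by_cases hd : d = 0
    · subst hd
      have : (0 : ZMod p) ≠ -b := by
        intro h; apply hb; rw [← neg_eq_zero, ← h]
      simp [this]
    simp only [if_neg hd]
    have h1 : ∀ c, ψ (-c - b * (c / d)) = ψ (c * (-1 - b / d)) := by
      intro c; congr 1; ring
    simp only [h1]
    have hprim : ψ.IsPrimitive := AddChar.IsPrimitive.of_ne_one hψ
    have := AddChar.sum_mulShift (-1 - b / d) hprim
    rw [this]
    have hiff : (-1 - b / d = 0) ↔ d = -b := by
      constructor
      · intro h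
        field_simp at h
        linear_combination -h
      · rintro rfl
        field_simp
        ring
    simp [hiff, ZMod.card]
  simp only [this]
  simp

open scoped Classical in
/-- counting with multiplicity -/
lemma sum_irr_pow_dvd (n : ℕ) (h : (ZMod p)[X]) (hm : h.Monic) (hn : h.natDegree = n)
    (T : Finset (ZMod p)[X])
    (hT : ∀ P, P ∈ T ↔ P.Monic ∧ Irreducible P ∧ P.natDegree ≤ n) :
    (n : ℂ) = ∑ P ∈ T, ∑ j ∈ Icc 1 n, if P ^ j ∣ h then (P.natDegree : ℂ) else 0 := by
  classical
  have hprod : (UniqueFactorizationMonoid.normalizedFactors h).prod = h := by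
    have := UniqueFactorizationMonoid.prod_normalizedFactors_eq hm.ne_zero
    rw [this, hm.normalize_eq_self]
  set m := UniqueFactorizationMonoid.normalizedFactors h with hmdef
  have hmon : ∀ P ∈ m, P.Monic := by
    intro P hP
    have h1 := UniqueFactorizationMonoid.normalize_normalized_factor P hP
    have h2 := UniqueFactorizationMonoid.irreducible_of_normalized_factor P hP
    rw [← h1]
    exact monic_normalize h2.ne_zero
  have hdeg : n = (m.map natDegree).sum := by
    rw [← hn, ← natDegree_multiset_prod_of_monic _ hmon, hprod]
  have hdeg2 : n = ∑ P ∈ T, m.count P * P.natDegree := by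
    rw [hdeg, Finset.sum_multiset_map_count]
    simp only [smul_eq_mul]
    apply Finset.sum_subset
    · intro P hP
      rw [Multiset.mem_toFinset] at hP
      rw [hT]
      refine ⟨hmon P hP, UniqueFactorizationMonoid.irreducible_of_normalized_factor P hP, ?_⟩
      rw [← hn]
      exact natDegree_le_of_dvd (UniqueFactorizationMonoid.dvd_of_mem_normalizedFactors hP)
        hm.ne_zero
    · intro P _ hP
      rw [Multiset.mem_toFinset] at hP
      rw [Multiset.count_eq_zero_of_notMem hP, zero_mul]
  conv_lhs => rw [hdeg2]
  push_cast
  apply Finset.sum_congr rfl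
  intro P hP
  rw [hT] at hP
  rw [← Finset.sum_filter, Finset.sum_const, nsmul_eq_mul]
  congr 2
  have hiff : ∀ j, P ^ j ∣ h ↔ j ≤ m.count P := by
    intro j
    rw [pow_dvd_iff_le_emultiplicity,
      UniqueFactorizationMonoid.emultiplicity_eq_count_normalizedFactors hP.2.1 hm.ne_zero,
      hP.1.normalize_eq_self]
    exact_mod_cast Iff.rfl
  have hle : m.count P ≤ n := by
    have h1 := (hiff (m.count P)).2 le_rfl
    have h2 := natDegree_le_of_dvd h1 hm.ne_zero
    rw [natDegree_pow, hn] at h2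
    have h3 : 0 < P.natDegree := hP.2.1.natDegree_pos
    nlinarith
  have : filter (fun j => P ^ j ∣ h) (Icc 1 n) = Icc 1 (m.count P) := by
    ext j
    rw [mem_filter, mem_Icc, mem_Icc, hiff]
    omega
  rw [this, Nat.card_Icc, Nat.add_sub_cancel]

open scoped Classical in
lemma sum_dvd_etaK (ψ : AddChar (ZMod p) ℂ) (b : ZMod p) (n : ℕ) (G : (ZMod p)[X]) (hG : G.Monic) :
    (∑ h ∈ monics p n, if G ∣ h then etaK ψ b h else 0)
      = if G.natDegree ≤ n then etaK ψ b G * SK ψ b (n - G.natDegree) else 0 := by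
  classical
  rw [← Finset.sum_filter]
  split_ifs with hle
  · rw [SK, Finset.mul_sum]
    symm
    apply Finset.sum_bij (fun g _ => G * g)
    · intro g hg
      rw [mem_monics] at hg
      rw [mem_filter, mem_monics]
      refine ⟨⟨hG.mul hg.1, ?_⟩, Dvd.intro _ rfl⟩
      rw [hG.natDegree_mul hg.1, hg.2]
      omega
    · intro g _ g' _ h
      exact mul_left_cancel₀ hG.ne_zero h
    · intro h hh
      rw [mem_filter, mem_monics] at hh
      obtain ⟨⟨h1, h2⟩, g, rfl⟩ := hh
      have hg : g.Monic := hG.of_mul_monic_left h1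
      refine ⟨g, ?_, rfl⟩
      rw [mem_monics]
      refine ⟨hg, ?_⟩
      rw [hG.natDegree_mul hg] at h2
      omega
    · intro g hg
      rw [mem_monics] at hg
      rw [etaK_mul _ _ _ _ hG hg.1]
  · apply Finset.sum_eq_zero
    intro h hh
    rw [mem_filter, mem_monics] at hh
    exfalso
    have := natDegree_le_of_dvd hh.2 hh.1.1.ne_zero
    omega

open scoped Classical in
/-- Newton type identity. -/
lemma SK_newton (ψ : AddChar (ZMod p) ℂ) (b : ZMod p) (n : ℕ)
    (T : Finset (ZMod p)[X])
    (hT : ∀ P, P ∈ T ↔ P.Monic ∧ Irreducible P ∧ P.natDegree ≤ n) :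
    (n : ℂ) * SK ψ b n = ∑ k ∈ Icc 1 n, (∑ P ∈ T, ∑ j ∈ Icc 1 n,
      if j * P.natDegree = k then (P.natDegree : ℂ) * etaK ψ b P ^ j else 0) * SK ψ b (n - k) := by
  have h1 : (n : ℂ) * SK ψ b n = ∑ P ∈ T, ∑ j ∈ Icc 1 n, ∑ h ∈ monics p n,
      (if P ^ j ∣ h then etaK ψ b h else 0) * (P.natDegree : ℂ) := by
    rw [SK, Finset.mul_sum]
    have : ∀ h ∈ monics p n, (n : ℂ) * etaK ψ b h = ∑ P ∈ T, ∑ j ∈ Icc 1 n,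
        (if P ^ j ∣ h then etaK ψ b h else 0) * (P.natDegree : ℂ) := by
      intro h hh
      rw [mem_monics] at hh
      rw [sum_irr_pow_dvd n h hh.1 hh.2 T hT, Finset.sum_mul]
      apply Finset.sum_congr rfl
      intro P _
      rw [Finset.sum_mul]
      apply Finset.sum_congr rfl
      intro j _
      split_ifs
      · ring
      · simp
    rw [Finset.sum_congr rfl this, Finset.sum_comm]
    apply Finset.sum_congr rfl
    intro P _
    rw [Finset.sum_comm]
  rw [h1]
  simp only [Finset.sum_mul]
  rw [Finset.sum_comm (s := Icc 1 n) (t := T)]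
  apply Finset.sum_congr rfl
  intro P hP
  rw [hT] at hP
  rw [Finset.sum_comm (s := Icc 1 n) (t := Icc 1 n)]
  apply Finset.sum_congr rfl
  intro j hj
  rw [mem_Icc] at hj
  have hpos : 0 < P.natDegree := hP.2.1.natDegree_pos
  rw [← Finset.sum_mul, sum_dvd_etaK _ _ _ _ (hP.1.pow j), natDegree_pow, etaK_pow _ _ _ hP.1]
  split_ifs with hle
  · rw [Finset.sum_eq_single (j * P.natDegree)]
    · rw [if_pos rfl]; ring
    · intro k _ hk
      rw [if_neg (Ne.symm hk), zero_mul]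
    · intro h
      exfalso
      apply h
      rw [mem_Icc]
      exact ⟨Nat.mul_pos hj.1 hpos, hle⟩
  · rw [zero_mul, Finset.sum_eq_zero]
    intro k hk
    rw [mem_Icc] at hk
    rw [if_neg (by omega), zero_mul]

end KloostermanL

section KloostermanL2
open Polynomial Finset

variable {p : ℕ} [Fact p.Prime]

lemma minpoly_inv_nextCoeff {E : Type*} [Field E] [Algebra (ZMod p) E]
    [FiniteDimensional (ZMod p) E] (x : E) (hx : x ≠ 0) :
    (minpoly (ZMod p) x⁻¹).nextCoeff =
      (minpoly (ZMod p) x).coeff 1 / (minpoly (ZMod p) x).coeff 0 := by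
  set P := minpoly (ZMod p) x with hP
  have hxalg : IsIntegral (ZMod p) x := .of_finite _ x
  have hxalg' : IsIntegral (ZMod p) x⁻¹ := .of_finite _ _
  have hc0 : P.coeff 0 ≠ 0 := minpoly.coeff_zero_ne_zero hxalg hx
  set R := C (P.coeff 0)⁻¹ * P.reverse with hR
  have hdegrev : P.reverse.natDegree = P.natDegree := by
    rw [reverse_natDegree]
    have : P.natTrailingDegree = 0 := by
      rw [natTrailingDegree_eq_zero]; right; exact hc0
    omega
  have hRdeg : R.natDegree = P.natDegree := by
    rw [hR, natDegree_C_mul (inv_ne_zero hc0), hdegrev]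
  have hRmon : R.Monic := by
    rw [Monic, hR, leadingCoeff_mul, leadingCoeff_C, reverse_leadingCoeff, trailingCoeff]
    have : P.natTrailingDegree = 0 := by
      rw [natTrailingDegree_eq_zero]; right; exact hc0
    rw [this, inv_mul_cancel₀ hc0]
  have hRroot : aeval x⁻¹ R = 0 := by
    rw [hR, map_mul]
    have : aeval x⁻¹ P.reverse = 0 := by
      letI : Invertible x := invertibleOfNonzero hx
      have h1 := (eval₂_reverse_eq_zero_iff (algebraMap (ZMod p) E) x P).2
        (by rw [← aeval_def]; exact minpoly.aeval _ _)
      rw [aeval_def]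
      simpa using h1
    rw [this, mul_zero]
  have hirr : minpoly (ZMod p) x⁻¹ ∣ R := minpoly.dvd _ _ hRroot
  have hdeg : (minpoly (ZMod p) x⁻¹).natDegree = P.natDegree := by
    rw [hP, ← IntermediateField.adjoin.finrank hxalg, ← IntermediateField.adjoin.finrank hxalg']
    have : IntermediateField.adjoin (ZMod p) {x⁻¹} = IntermediateField.adjoin (ZMod p) {x} := by
      apply le_antisymm
      · rw [IntermediateField.adjoin_simple_le_iff]
        exact inv_mem (IntermediateField.mem_adjoin_simple_self _ x)
      · rw [IntermediateField.adjoin_simple_le_iff]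
        have := inv_mem (IntermediateField.mem_adjoin_simple_self (ZMod p) x⁻¹)
        rwa [inv_inv] at this
    rw [this]
  have heq : minpoly (ZMod p) x⁻¹ = R := by
    symm
    apply eq_of_monic_of_dvd_of_natDegree_le (minpoly.monic hxalg') hRmon hirr
    rw [hRdeg, hdeg]
  have hpos : 0 < P.natDegree := minpoly.natDegree_pos hxalg
  rw [heq, nextCoeff_of_natDegree_pos (by rw [hRdeg]; exact hpos), hRdeg, hR, coeff_C_mul,
    coeff_reverse, revAt_le (by omega), Nat.sub_sub_self (by omega)]
  field_simp

lemma etaK_minpoly {E : Type*} [Field E] [DecidableEq E] [Algebra (ZMod p) E]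
    [FiniteDimensional (ZMod p) E] (ψ : AddChar (ZMod p) ℂ) (b : ZMod p) (x : E) :
    etaK ψ b (minpoly (ZMod p) x) ^
        (Module.finrank (ZMod p) E / (minpoly (ZMod p) x).natDegree) =
      if x = 0 then 0 else
        ψ (Algebra.trace (ZMod p) E x + b * Algebra.trace (ZMod p) E x⁻¹) := by
  have hxalg : IsIntegral (ZMod p) x := .of_finite _ x
  have hfr := Module.finrank_mul_finrank (ZMod p) (IntermediateField.adjoin (ZMod p) {x}) E
  rw [IntermediateField.adjoin.finrank hxalg] at hfr
  have hpos : 0 < (minpoly (ZMod p) x).natDegree := minpoly.natDegree_pos hxalg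
  have hq : Module.finrank (ZMod p) E / (minpoly (ZMod p) x).natDegree =
      Module.finrank (IntermediateField.adjoin (ZMod p) {x}) E := by
    rw [← hfr, Nat.mul_div_cancel_left _ hpos]
  split_ifs with hx
  · subst hx
    rw [hq]
    have : Module.finrank (IntermediateField.adjoin (ZMod p) {(0 : E)}) E ≠ 0 :=
      Module.finrank_pos.ne'
    rw [minpoly.zero, etaK]
    simp [this]
  · have hc0 : (minpoly (ZMod p) x).coeff 0 ≠ 0 := minpoly.coeff_zero_ne_zero hxalg hx
    have hadj : IntermediateField.adjoin (ZMod p) {x⁻¹} = IntermediateField.adjoin (ZMod p) {x} := by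
      apply le_antisymm
      · rw [IntermediateField.adjoin_simple_le_iff]
        exact inv_mem (IntermediateField.mem_adjoin_simple_self _ x)
      · rw [IntermediateField.adjoin_simple_le_iff]
        have := inv_mem (IntermediateField.mem_adjoin_simple_self (ZMod p) x⁻¹)
        rwa [inv_inv] at this
    rw [hq, trace_eq_finrank_mul_minpoly_nextCoeff, trace_eq_finrank_mul_minpoly_nextCoeff,
      minpoly_inv_nextCoeff x hx, etaK, if_neg hc0, ← AddChar.map_nsmul_eq_pow, hadj]
    congr 1
    rw [nsmul_eq_mul]
    ring

open scoped Classical in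
lemma card_minpoly_fiber {E : Type*} [Field E] [Fintype E] [Algebra (ZMod p) E]
    (P : (ZMod p)[X]) (hm : P.Monic) (hi : Irreducible P) :
    (univ.filter (fun x : E => minpoly (ZMod p) x = P)).card =
      if P.natDegree ∣ Module.finrank (ZMod p) E then P.natDegree else 0 := by
  have hmin : ∀ x : E, minpoly (ZMod p) x = P ↔ aeval x P = 0 := by
    intro x
    constructor
    · rintro rfl; exact minpoly.aeval _ _
    · intro h; exact (minpoly.eq_of_irreducible_of_monic hi h hm).symm
  split_ifs with hd
  · have hsep : P.Separable := PerfectField.separable_of_irreducible hi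
    have hcard : Fintype.card E = p ^ Module.finrank (ZMod p) E := by
      rw [Module.card_eq_pow_finrank (K := ZMod p), ZMod.card]
    have hsplit : (P.map (algebraMap (ZMod p) E)).Splits := by
      have h1 := (hi.natDegree_dvd_iff_dvd_X_pow_card_pow_sub_X).1 hd
      rw [Nat.card_eq_fintype_card, ZMod.card, ← hcard] at h1
      refine Splits.of_dvd (FiniteField.splits_X_pow_card_sub_X (K := E) (p := p)) ?_
        (Polynomial.map_dvd _ h1)
      apply Polynomial.map_ne_zero
      exact FiniteField.X_pow_card_sub_X_ne_zero _ Fintype.one_lt_card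
    rw [← card_rootSet_eq_natDegree hsep hsplit, ← Set.toFinset_card]
    congr 1
    ext x
    simp [hmin, mem_rootSet, hm.ne_zero]
  · rw [card_eq_zero, filter_eq_empty_iff]
    intro x _ h
    apply hd
    rw [← h]
    exact minpoly.degree_dvd (.of_finite _ x)

/-- Kloosterman sum over an extension. -/
noncomputable def KE (ψ : AddChar (ZMod p) ℂ) (b : ZMod p) (E : Type*) [Field E] [Fintype E]
    [DecidableEq E] [Algebra (ZMod p) E] : ℂ :=
  ∑ x : E, if x = 0 then 0 else
        ψ (Algebra.trace (ZMod p) E x + b * Algebra.trace (ZMod p) E x⁻¹)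

lemma KE_eq {E : Type*} [Field E] [Fintype E] [DecidableEq E] [Algebra (ZMod p) E]
    (ψ : AddChar (ZMod p) ℂ) (b : ZMod p) (n k : ℕ) (hk : Module.finrank (ZMod p) E = k)
    (hk1 : 1 ≤ k) (hkn : k ≤ n)
    (T : Finset (ZMod p)[X])
    (hT : ∀ P, P ∈ T ↔ P.Monic ∧ Irreducible P ∧ P.natDegree ≤ n) :
    KE ψ b E = ∑ P ∈ T, ∑ j ∈ Icc 1 n,
      if j * P.natDegree = k then (P.natDegree : ℂ) * etaK ψ b P ^ j else 0 := by
  classical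
  rw [KE, Finset.sum_congr rfl (fun x _ => (etaK_minpoly ψ b x).symm)]
  rw [← Finset.sum_fiberwise_of_maps_to (t := T) (g := fun x : E => minpoly (ZMod p) x)]
  · apply Finset.sum_congr rfl
    intro P hP
    rw [hT] at hP
    have hpos : 0 < P.natDegree := hP.2.1.natDegree_pos
    rw [Finset.sum_congr rfl (g := fun _ => etaK ψ b P ^ (k / P.natDegree))]
    · rw [Finset.sum_const, card_minpoly_fiber P hP.1 hP.2.1, hk, nsmul_eq_mul]
      split_ifs with hd
      · obtain ⟨j, rfl⟩ := hd
        rw [Nat.mul_div_cancel_left _ hpos, Finset.sum_eq_single j]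
        · rw [if_pos (mul_comm _ _)]
        · intro i _ hij
          rw [if_neg]
          intro h
          rw [mul_comm] at h
          exact hij (Nat.eq_of_mul_eq_mul_left hpos h)
        · intro h
          exfalso
          apply h
          rw [mem_Icc]
          constructor
          · rcases Nat.eq_zero_or_pos j with rfl | h
            · simp at hk1
            · exact h
          · nlinarith
      · rw [Nat.cast_zero, zero_mul, Finset.sum_eq_zero]
        intro j _
        rw [if_neg]
        rintro rfl
        exact hd (Dvd.intro_left _ rfl)
    · intro x hx
      rw [mem_filter] at hx
      rw [hx.2, hk]
  · intro x _
    have hxalg : IsIntegral (ZMod p) x := .of_finite _ x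
    rw [hT]
    refine ⟨minpoly.monic hxalg, minpoly.irreducible hxalg, ?_⟩
    refine le_trans (Nat.le_of_dvd (by omega) ?_) hkn
    rw [← hk]
    exact minpoly.degree_dvd hxalg

/-- Kloosterman sum over the degree `k` extension. -/
noncomputable def KG (ψ : AddChar (ZMod p) ℂ) (b : ZMod p) (k : ℕ) : ℂ :=
  letI := Fintype.ofFinite (GaloisField p k)
  letI := Classical.decEq (GaloisField p k)
  KE ψ b (GaloisField p k)

lemma newton_KG (ψ : AddChar (ZMod p) ℂ) (b : ZMod p) (n : ℕ) :
    (n : ℂ) * SK ψ b n = ∑ k ∈ Icc 1 n, KG ψ b k * SK ψ b (n - k) := by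
  classical
  let T : Finset (ZMod p)[X] := ((range (n + 1)).biUnion (monics p)).filter Irreducible
  have hT : ∀ P, P ∈ T ↔ P.Monic ∧ Irreducible P ∧ P.natDegree ≤ n := by
    intro P
    simp only [T, mem_filter, mem_biUnion, mem_range, mem_monics]
    constructor
    · rintro ⟨⟨d, hd, h1, h2⟩, h3⟩
      exact ⟨h1, h3, by omega⟩
    · rintro ⟨h1, h2, h3⟩
      exact ⟨⟨P.natDegree, by omega, h1, rfl⟩, h2⟩
  rw [SK_newton ψ b n T hT]
  apply Finset.sum_congr rfl
  intro k hk
  rw [mem_Icc] at hk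
  congr 1
  symm
  letI := Fintype.ofFinite (GaloisField p k)
  exact KE_eq ψ b n k (GaloisField.finrank p (by omega)) hk.1 hk.2 T hT

lemma KG_one (ψ : AddChar (ZMod p) ℂ) (b : ZMod p) : KG ψ b 1 = SK ψ b 1 := by
  have := newton_KG ψ b 1
  simpa [SK_zero] using this.symm

lemma KG_two (ψ : AddChar (ZMod p) ℂ) (hψ : ψ ≠ 1) (b : ZMod p) (hb : b ≠ 0) :
    KG ψ b 2 = 2 * p - KG ψ b 1 ^ 2 := by
  have := newton_KG ψ b 2
  rw [show Icc 1 2 = {1, 2} by rfl, Finset.sum_pair (by norm_num)] at this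
  simp only [Nat.reduceSub, SK_zero, SK_two ψ hψ b hb, ← KG_one] at this
  push_cast at this
  linear_combination -this

lemma KG_rec (ψ : AddChar (ZMod p) ℂ) (hψ : ψ ≠ 1) (b : ZMod p) (hb : b ≠ 0) (n : ℕ) :
    KG ψ b (n + 3) = - KG ψ b 1 * KG ψ b (n + 2) - p * KG ψ b (n + 1) := by
  have := newton_KG ψ b (n + 3)
  rw [SK_large ψ hψ b (n + 3) (by omega), mul_zero] at this
  rw [Finset.sum_Icc_succ_top (by omega), Finset.sum_Icc_succ_top (by omega),
    Finset.sum_Icc_succ_top (by omega), Finset.sum_eq_zero] at this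
  · rw [show n + 2 + 1 - (n + 2 + 1) = 0 by omega, show n + 2 + 1 - (n + 1 + 1) = 1 by omega,
      show n + 2 + 1 - (n + 1) = 2 by omega, SK_zero, SK_two ψ hψ b hb, ← KG_one] at this
    linear_combination -this
  · intro k hk
    rw [mem_Icc] at hk
    rw [SK_large ψ hψ b _ (by omega), mul_zero]

/-- The Kloosterman sum over the prime field. -/
lemma KG_one_eq (ψ : AddChar (ZMod p) ℂ) (b : ZMod p) :
    KG ψ b 1 = ∑ x : ZMod p, if x = 0 then 0 else ψ (x + b * x⁻¹) := by
  rw [KG_one, SK]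
  have hm : ∀ c : ZMod p, (X - C c : (ZMod p)[X]) ∈ monics p 1 := fun c => by
    rw [mem_monics]; exact ⟨monic_X_sub_C c, natDegree_X_sub_C c⟩
  symm
  refine Finset.sum_bij' (fun c _ => (X - C c : (ZMod p)[X])) (fun h _ => - h.coeff 0)
    ?_ ?_ ?_ ?_ ?_
  · intro c _; exact hm c
  · intro h _; exact mem_univ _
  · intro c _; simp
  · intro h hh
    rw [mem_monics] at hh
    have h2 : h.coeff 1 = 1 := by rw [← hh.2]; exact hh.1
    conv_rhs => rw [h.as_sum_range_C_mul_X_pow' (show h.natDegree < 2 by omega)]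
    simp [Finset.sum_range_succ, h2]
    ring
  · intro c _
    unfold etaK
    rw [nextCoeff_X_sub_C]
    simp only [coeff_sub, coeff_X_zero, coeff_C_zero, coeff_X_one, coeff_C_succ, zero_sub,
      neg_eq_zero, sub_zero, neg_neg]
    split_ifs
    · rfl
    · congr 1
      rw [one_div, inv_neg]
      ring

end KloostermanL2

section KloostermanWeil
open Polynomial Finset

lemma seq_binet (V : ℕ → ℝ) (r P : ℝ) (α β : ℂ) (h1 : V 1 = r) (h2 : V 2 = 2 * P - r ^ 2)
    (hrec : ∀ n, V (n + 3) = - r * V (n + 2) - P * V (n + 1)) (hs : α + β = -r) (hp : α * β = P) :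
    ∀ n, ((V (n + 1) : ℝ) : ℂ) = - (α ^ (n + 1) + β ^ (n + 1)) ∧
      ((V (n + 2) : ℝ) : ℂ) = - (α ^ (n + 2) + β ^ (n + 2)) := by
  intro n
  induction n with
  | zero =>
    constructor
    · simp only [zero_add, h1, pow_one, hs, neg_neg]
    · simp only [zero_add, h2]
      push_cast
      rw [← hp]
      have : (r : ℂ) = -(α + β) := by rw [hs]; ring
      rw [this]; ring
  | succ n ih =>
    refine ⟨ih.2, ?_⟩
    rw [show n + 1 + 2 = n + 3 by ring, hrec]
    push_cast
    rw [ih.1, ih.2, ← hp]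
    have : (r : ℂ) = -(α + β) := by rw [hs]; ring
    rw [this]; ring

lemma seq_bound (V : ℕ → ℝ) (r P : ℝ) (hP : 0 < P) (h1 : V 1 = r) (h2 : V 2 = 2 * P - r ^ 2)
    (hrec : ∀ n, V (n + 3) = - r * V (n + 2) - P * V (n + 1)) :
    (∀ m, V (2 * (m + 1)) ≤ 2 * P ^ (m + 1)) ∧
    (4 * P < r ^ 2 → ∃ l, P < l ∧ ∀ m, V (2 * (m + 1)) ≤ - l ^ (m + 1)) := by
  rcases le_or_gt (r ^ 2) (4 * P) with hle | hgt
  · refine ⟨?_, fun h => absurd h (not_lt.2 hle)⟩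
    set s := Real.sqrt (4 * P - r ^ 2) with hs
    have hs2 : s ^ 2 = 4 * P - r ^ 2 := Real.sq_sqrt (by linarith)
    have hs2c : (s : ℂ) ^ 2 = 4 * P - r ^ 2 := by exact_mod_cast hs2
    have hI : Complex.I ^ 2 = -1 := Complex.I_sq
    have hb := seq_binet V r P ((-r + s * Complex.I) / 2) ((-r - s * Complex.I) / 2) h1 h2 hrec
      (by ring) (by linear_combination (-s^2 / 4 : ℂ) * hI + (1 / 4 : ℂ) * hs2c)
    intro m
    have h3 := (hb (2 * m)).2
    rw [show 2 * m + 2 = 2 * (m + 1) by ring] at h3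
    have n1 : ‖((-r + s * Complex.I) / 2 : ℂ)‖ ^ 2 = P := by
      rw [← Complex.normSq_eq_norm_sq, Complex.normSq_apply]
      simp
      nlinarith
    have n2 : ‖((-r - s * Complex.I) / 2 : ℂ)‖ ^ 2 = P := by
      rw [← Complex.normSq_eq_norm_sq, Complex.normSq_apply]
      simp
      nlinarith
    calc V (2 * (m + 1)) ≤ |V (2 * (m + 1))| := le_abs_self _
      _ = ‖((V (2 * (m + 1)) : ℝ) : ℂ)‖ := by rw [Complex.norm_real, Real.norm_eq_abs]
      _ ≤ 2 * P ^ (m + 1) := by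
        rw [h3, norm_neg]
        refine (norm_add_le _ _).trans ?_
        rw [norm_pow, norm_pow, pow_mul, pow_mul, n1, n2]
        linarith
  · set s := Real.sqrt (r ^ 2 - 4 * P) with hs
    have hs2 : s ^ 2 = r ^ 2 - 4 * P := Real.sq_sqrt (by linarith)
    have hs0 : 0 ≤ s := Real.sqrt_nonneg _
    have hs2c : (s : ℂ) ^ 2 = r ^ 2 - 4 * P := by exact_mod_cast hs2
    have hb := seq_binet V r P (((-r + s) / 2 : ℝ) : ℂ) (((-r - s) / 2 : ℝ) : ℂ) h1 h2 hrec
      (by push_cast; ring) (by push_cast; linear_combination (-1 / 4 : ℂ) * hs2c)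
    have hb' : ∀ m, V (2 * (m + 1)) =
        -((((-r + s) / 2) ^ 2) ^ (m + 1) + (((-r - s) / 2) ^ 2) ^ (m + 1)) := by
      intro m
      have h3 := (hb (2 * m)).2
      rw [show 2 * m + 2 = 2 * (m + 1) by ring] at h3
      rw [← pow_mul, ← pow_mul]
      exact_mod_cast h3
    have p1 : ∀ m : ℕ, 0 ≤ (((-r + s) / 2) ^ 2) ^ (m + 1) := fun m => by positivity
    have p2 : ∀ m : ℕ, 0 ≤ (((-r - s) / 2) ^ 2) ^ (m + 1) := fun m => by positivity
    refine ⟨fun m => ?_, fun _ => ?_⟩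
    · rw [hb' m]
      have : 0 ≤ P ^ (m + 1) := by positivity
      linarith [p1 m, p2 m]
    · rcases le_total r 0 with hr | hr
      · refine ⟨((-r + s) / 2) ^ 2, by nlinarith [mul_nonneg (neg_nonneg.2 hr) hs0], fun m => ?_⟩
        rw [hb' m]
        linarith [p2 m]
      · refine ⟨((-r - s) / 2) ^ 2, by nlinarith [mul_nonneg hr hs0], fun m => ?_⟩
        rw [hb' m]
        linarith [p1 m]

variable {p : ℕ} [Fact p.Prime]

lemma pair_upper {E : Type*} [Field E] [Fintype E] [DecidableEq E] [Algebra (ZMod p) E]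
    (b : ZMod p) :
    (univ.filter (fun z : E × E => z.1 ≠ 0 ∧ z.2 ^ p - z.2 = z.1 + algebraMap _ E b * z.1⁻¹)).card ≤
    p * (univ.filter (fun x : E => x ≠ 0 ∧
      Algebra.trace (ZMod p) E x + b * Algebra.trace (ZMod p) E x⁻¹ = 0)).card := by
  have hp1 : 1 < p := (Fact.out : p.Prime).one_lt
  refine Finset.card_le_mul_card_image_of_maps_to (f := Prod.fst) ?_ p ?_
  · rintro ⟨x, y⟩ h
    simp only [mem_filter, mem_univ, true_and] at h ⊢
    refine ⟨h.1, ?_⟩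
    have h1 : Algebra.trace (ZMod p) E (y ^ p) = Algebra.trace (ZMod p) E y := by
      have := Algebra.trace_eq_of_algEquiv
        (FiniteField.frobeniusAlgEquivOfAlgebraic (ZMod p) E) y
      simpa [FiniteField.coe_frobeniusAlgEquivOfAlgebraic, ZMod.card] using this
    have h2 := congrArg (Algebra.trace (ZMod p) E) h.2
    rw [map_sub, h1, sub_self, map_add, ← Algebra.smul_def, map_smul, smul_eq_mul] at h2
    exact h2.symm
  · intro x hx
    have hdeg : (X ^ p - X - C (x + algebraMap _ E b * x⁻¹) : E[X]).natDegree = p := by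
      rw [natDegree_sub_C, FiniteField.X_pow_card_sub_X_natDegree_eq _ hp1]
    have hne : (X ^ p - X - C (x + algebraMap _ E b * x⁻¹) : E[X]) ≠ 0 := by
      intro h
      rw [h, natDegree_zero] at hdeg
      omega
    calc _ ≤ ((univ.filter (fun y : E => y ^ p - y = x + algebraMap _ E b * x⁻¹))).card := by
          apply Finset.card_le_card_of_injOn Prod.snd
          · rintro ⟨x', y⟩ h
            simp only [coe_filter, mem_filter, mem_univ, true_and, Set.mem_setOf_eq] at h ⊢
            obtain ⟨⟨_, h⟩, rfl⟩ := h
            exact h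
          · rintro ⟨x', y⟩ h ⟨x'', y'⟩ h' hy
            simp only [coe_filter, mem_filter, mem_univ, true_and, Set.mem_setOf_eq] at h h' hy
            rw [h.2, h'.2, hy]
      _ ≤ _ := by
          conv_rhs => rw [← hdeg]
          apply card_le_degree_of_subset_roots
          intro y hy
          simp only [Finset.filter_val, Multiset.mem_filter, Finset.mem_val, Finset.mem_univ,
            true_and] at hy
          rw [mem_roots hne]
          simp [IsRoot, hy]

lemma pair_lower {E : Type*} [Field E] [Fintype E] [DecidableEq E] [Algebra (ZMod p) E]
    (hp2 : p ≠ 2) (b : ZMod p) (hb : b ≠ 0) (μ : ℕ) (hμ : 3 ≤ μ)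
    (hcard : Fintype.card E = (p ^ μ) ^ 2) :
    (p ^ μ) ^ 2 ≤ (univ.filter (fun z : E × E =>
      z.1 ≠ 0 ∧ z.2 ^ p - z.2 = z.1 + algebraMap _ E b * z.1⁻¹)).card + 10 * p * p ^ μ := by
  have hpp : p.Prime := Fact.out
  have hodd : Odd p := hpp.odd_of_ne_two hp2
  have hp3 : 3 ≤ p := by
    have := hpp.two_le
    omega
  haveI : CharP E p := charP_of_injective_algebraMap (algebraMap (ZMod p) E).injective p
  set B : E := algebraMap _ E b with hB
  have hB0 : B ≠ 0 := by
    rw [hB]; simpa using hb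
  have h2ne : (2 : E) ≠ 0 := by
    have : ringChar E ≠ 2 := by
      rw [ringChar.eq E p]; exact hp2
    exact Ring.two_ne_zero this
  have h4 : (4 : E) ≠ 0 := by
    have : (4 : E) = 2 * 2 := by norm_num
    rw [this]; exact mul_ne_zero h2ne h2ne
  set w : E[X] := X ^ p - X with hw
  have hwdeg : w.natDegree = p := FiniteField.X_pow_card_sub_X_natDegree_eq _ hpp.one_lt
  set f : E[X] := w ^ 2 - C (4 * B) with hf
  have hfdeg : f.natDegree = 2 * p := by
    rw [hf, natDegree_sub_C, natDegree_pow, hwdeg]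
  have hf0 : f.eval 0 ≠ 0 := by
    simp [hf, hw, hpp.ne_zero, h4, hB0]
  have hsep : f.Separable := by
    refine ⟨-C (4 * B)⁻¹, -w * C (2 * (4 * B))⁻¹, ?_⟩
    have hder : derivative f = -2 * w := by
      rw [hf, hw]
      simp only [derivative_sub, derivative_pow, derivative_X, derivative_C, derivative_X_pow]
      have e0 : (C 2 : E[X]) = 2 := map_ofNat C 2
      simp [e0]
      try ring
    rw [hder, hf]
    have e1 : C (4 * B)⁻¹ * C (4 * B) = (1 : E[X]) := by
      rw [← C_mul, inv_mul_cancel₀ (mul_ne_zero h4 hB0), C_1]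
    have e2 : (2 : E[X]) * C (2 * (4 * B))⁻¹ = C (4 * B)⁻¹ := by
      rw [show (2 : E[X]) = C 2 from (map_ofNat C 2).symm, ← C_mul]
      congr 1
      field_simp
    linear_combination e1 + w ^ 2 * e2
  have hsq : Squarefree f := hsep.squarefree
  have hPodd : Odd (p ^ μ) := hodd.pow
  have hP3 : p ^ 3 ≤ p ^ μ := Nat.pow_le_pow_right (by omega) hμ
  have hbig : 2 * p ^ 2 + 2 * p < p ^ μ := by
    refine lt_of_lt_of_le ?_ hP3
    nlinarith
  have hst := stp_bound (K := E) p μ hcard hPodd f hsq p (by omega) hfdeg hf0 hbig (-1)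
  set P := p ^ μ with hP
  have hcard2 : Fintype.card E / 2 = (P ^ 2 - 1) / 2 := by
    rw [hcard]
    obtain ⟨k, hk⟩ := hPodd.pow (n := 2)
    omega
  set S1 := univ.filter (fun y : E => (f.eval y) ^ ((P ^ 2 - 1) / 2) = 1)
  set Sm := univ.filter (fun y : E => (f.eval y) ^ ((P ^ 2 - 1) / 2) = -1)
  set S0 := univ.filter (fun y : E => f.eval y = 0)
  have hS0 : S0.card ≤ 2 * p := by
    rw [← hfdeg]
    apply card_le_degree_of_subset_roots
    intro y hy
    simp only [S0, Finset.filter_val, Multiset.mem_filter, Finset.mem_val, Finset.mem_univ,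
            true_and] at hy
    rw [mem_roots (by rintro h; rw [h] at hf0; simp at hf0)]
    exact hy
  have hchar : ringChar E ≠ 2 := by rw [ringChar.eq E p]; exact hp2
  have htot : P ^ 2 ≤ S1.card + Sm.card + S0.card := by
    rw [← hcard, ← Finset.card_univ]
    have : (univ : Finset E) ⊆ S1 ∪ Sm ∪ S0 := by
      intro y _
      simp only [S1, Sm, S0, mem_union, mem_filter, mem_univ, true_and]
      by_cases hy : f.eval y = 0
      · right; exact hy
      · left
        rw [← hcard2]
        exact FiniteField.pow_dichotomy hchar hy
    refine (card_le_card this).trans ((card_union_le _ _).trans ?_)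
    exact Nat.add_le_add_right (card_union_le _ _) _
  have hW : 2 * S1.card ≤ (univ.filter (fun z : E × E =>
      z.1 ≠ 0 ∧ z.2 ^ p - z.2 = z.1 + B * z.1⁻¹)).card := by
    refine le_trans (Finset.mul_card_image_le_card_of_maps_to (f := Prod.snd)
      (s := (univ.filter (fun z : E × E =>
      z.1 ≠ 0 ∧ z.2 ^ p - z.2 = z.1 + B * z.1⁻¹)).filter (fun z => z.2 ∈ S1)) ?_ 2 ?_)
      (card_le_card (filter_subset _ _))
    · intro z hz
      exact (mem_filter.1 hz).2
    · intro y hy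
      have hy1 : (f.eval y) ^ ((P ^ 2 - 1) / 2) = 1 := by simpa [S1] using hy
      have hexp : (P ^ 2 - 1) / 2 ≠ 0 := by
        have : 3 ≤ P := by nlinarith
        have : 9 ≤ P ^ 2 := by nlinarith
        omega
      have hy0 : f.eval y ≠ 0 := by
        intro h
        rw [h, zero_pow hexp] at hy1
        exact zero_ne_one hy1
      obtain ⟨z, hz⟩ : IsSquare (f.eval y) := by
        rw [FiniteField.isSquare_iff hchar hy0, hcard2]; exact hy1
      have hz0 : z ≠ 0 := by rintro rfl; exact hy0 (by rw [hz]; simp)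
      have hfy : (y ^ p - y) ^ 2 - 4 * B = z * z := by
        rw [← hz, hf, hw]; simp
      have key : ∀ t : E, t * t = z * z → (y ^ p - y + t) / 2 ≠ 0 ∧
          y ^ p - y = (y ^ p - y + t) / 2 + B * ((y ^ p - y + t) / 2)⁻¹ := by
        intro t ht
        have hprod : ((y ^ p - y + t) / 2) * ((y ^ p - y - t) / 2) = B := by
          field_simp
          linear_combination hfy - ht
        have hne : (y ^ p - y + t) / 2 ≠ 0 := by
          intro h
          rw [h, zero_mul] at hprod
          exact hB0 hprod.symm
        refine ⟨hne, ?_⟩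
        have : B * ((y ^ p - y + t) / 2)⁻¹ = (y ^ p - y - t) / 2 := by
          rw [← hprod, mul_comm, ← mul_assoc, inv_mul_cancel₀ hne, one_mul]
        rw [this]; field_simp; ring
      have hsub : ({((y ^ p - y + z) / 2, y), ((y ^ p - y + -z) / 2, y)} : Finset (E × E)) ⊆
          ((univ.filter (fun z : E × E =>
      z.1 ≠ 0 ∧ z.2 ^ p - z.2 = z.1 + B * z.1⁻¹)).filter (fun z => z.2 ∈ S1)).filter
        (fun z => z.2 = y) := by
        intro u hu
        rw [mem_insert, mem_singleton] at hu
        rcases hu with rfl | rfl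
        · exact mem_filter.2 ⟨mem_filter.2 ⟨mem_filter.2 ⟨mem_univ _, key z rfl⟩, hy⟩, rfl⟩
        · exact mem_filter.2 ⟨mem_filter.2 ⟨mem_filter.2 ⟨mem_univ _, key (-z) (by ring)⟩, hy⟩, rfl⟩
      refine le_trans (le_of_eq ?_) (card_le_card hsub)
      rw [card_pair]
      intro h
      have h1 := congrArg Prod.fst h
      simp only at h1
      have h3 : 2 * z = 0 := by
        have := (div_left_inj' h2ne).1 h1
        linear_combination this
      exact hz0 ((mul_eq_zero.1 h3).resolve_left h2ne)
  have hP1 : 1 ≤ P := by nlinarith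
  nlinarith [hS0, htot, hW, hst, Nat.mul_le_mul_left p hP1]

end KloostermanWeil

section KloostermanWeil2
open Polynomial Finset

variable {p : ℕ} [Fact p.Prime]

lemma sum_KE_lower {E : Type*} [Field E] [Fintype E] [DecidableEq E] [Algebra (ZMod p) E]
    [DecidableEq (AddChar (ZMod p) ℂ)]
    (hp2 : p ≠ 2) (b : ZMod p) (hb : b ≠ 0) (μ : ℕ) (hμ : 3 ≤ μ)
    (hcard : Fintype.card E = (p ^ μ) ^ 2) :
    -(10 * p * (p : ℝ) ^ μ) ≤ ∑ ψ ∈ (univ : Finset (AddChar (ZMod p) ℂ)).erase 1, (KE ψ b E).re := by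
  have h1 := pair_upper (p := p) (E := E) b
  have h2 := pair_lower hp2 b hb μ hμ hcard
  have h3 : ∑ ψ : AddChar (ZMod p) ℂ, KE ψ b E = p * ((univ.filter (fun x : E => x ≠ 0 ∧
      Algebra.trace (ZMod p) E x + b * Algebra.trace (ZMod p) E x⁻¹ = 0)).card : ℂ) := by
    unfold KE
    rw [Finset.sum_comm, Finset.card_filter, Nat.cast_sum, Finset.mul_sum]
    refine Finset.sum_congr rfl fun x _ => ?_
    by_cases hx : x = 0
    · simp [hx]
    · simp only [hx, if_false, AddChar.sum_apply_eq_ite, ZMod.card]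
      by_cases h : Algebra.trace (ZMod p) E x + b * Algebra.trace (ZMod p) E x⁻¹ = 0 <;> simp [h, hx]
  have h4 : KE (1 : AddChar (ZMod p) ℂ) b E = ((p : ℂ) ^ μ) ^ 2 - 1 := by
    unfold KE
    have : ∀ x : E, (if x = 0 then (0 : ℂ) else (1 : AddChar (ZMod p) ℂ)
        (Algebra.trace (ZMod p) E x + b * Algebra.trace (ZMod p) E x⁻¹)) =
        1 - if x = 0 then 1 else 0 := by
      intro x
      split_ifs <;> simp
    simp_rw [this]
    rw [Finset.sum_sub_distrib]
    simp [hcard]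
  rw [← Finset.add_sum_erase _ _ (mem_univ (1 : AddChar (ZMod p) ℂ)), h4] at h3
  have h5 := congrArg Complex.re h3
  rw [Complex.add_re, Complex.re_sum] at h5
  have h6 : (p * ((univ.filter (fun x : E => x ≠ 0 ∧
      Algebra.trace (ZMod p) E x + b * Algebra.trace (ZMod p) E x⁻¹ = 0)).card : ℂ)).re =
      p * ((univ.filter (fun x : E => x ≠ 0 ∧
      Algebra.trace (ZMod p) E x + b * Algebra.trace (ZMod p) E x⁻¹ = 0)).card : ℝ) := by
    rw [← Nat.cast_mul, Complex.natCast_re]; push_cast; rfl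
  have h7 : (((p : ℂ) ^ μ) ^ 2 - 1).re = ((p : ℝ) ^ μ) ^ 2 - 1 := by
    have : (((p : ℂ) ^ μ) ^ 2 - 1) = (((((p : ℝ) ^ μ) ^ 2 - 1 : ℝ)) : ℂ) := by push_cast; rfl
    rw [this, Complex.ofReal_re]
  rw [h6, h7] at h5
  have h8 := h2.trans (Nat.add_le_add_right h1 _)
  have h9 : ((p : ℝ) ^ μ) ^ 2 ≤ p * ((univ.filter (fun x : E => x ≠ 0 ∧
      Algebra.trace (ZMod p) E x + b * Algebra.trace (ZMod p) E x⁻¹ = 0)).card : ℝ) +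
      10 * p * p ^ μ := by exact_mod_cast h8
  linarith

lemma KG_one_conj (ψ : AddChar (ZMod p) ℂ) (b : ZMod p) :
    (starRingEnd ℂ) (KG ψ b 1) = KG ψ b 1 := by
  rw [KG_one_eq, map_sum, ← Equiv.sum_comp (Equiv.neg (ZMod p))]
  refine Finset.sum_congr rfl fun x _ => ?_
  by_cases hx : x = 0
  · simp [hx]
  · simp only [Equiv.neg_apply, neg_eq_zero, hx, if_false, inv_neg, mul_neg]
    rw [← neg_add, AddChar.map_neg_eq_conj, Complex.conj_conj]

theorem weil_odd (hp2 : p ≠ 2) (ψ : AddChar (ZMod p) ℂ) (hψ : ψ ≠ 1) (b : ZMod p) (hb : b ≠ 0) :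
    ‖∑ x : ZMod p, if x = 0 then 0 else ψ (x + b * x⁻¹)‖ ≤ 2 * Real.sqrt p := by
  classical
  have hpp : p.Prime := Fact.out
  have hp0 : (0 : ℝ) < p := by exact_mod_cast hpp.pos
  rw [← KG_one_eq]
  have hreal : ∀ φ : AddChar (ZMod p) ℂ, KG φ b 1 = ((KG φ b 1).re : ℂ) := fun φ =>
    (Complex.conj_eq_iff_re.1 (KG_one_conj φ b)).symm
  have hsb : ∀ φ : AddChar (ZMod p) ℂ, φ ≠ 1 → _ := fun φ hφ =>
    seq_bound (fun n => (KG φ b n).re) (KG φ b 1).re p hp0 rfl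
      (by
        show (KG φ b 2).re = _
        rw [KG_two φ hφ b hb, hreal φ]
        have : (2 * (p : ℂ) - (((KG φ b 1).re : ℝ) : ℂ) ^ 2) =
          ((2 * p - (KG φ b 1).re ^ 2 : ℝ) : ℂ) := by push_cast; rfl
        rw [this, Complex.ofReal_re]
        simp)
      (by
        intro n
        show (KG φ b (n + 3)).re = _
        rw [KG_rec φ hφ b hb, hreal φ, ← Complex.ofReal_neg, Complex.sub_re, Complex.re_ofReal_mul,
          ← Complex.ofReal_natCast, Complex.re_ofReal_mul]
        simp)
  have hnn : ‖KG ψ b 1‖ = |(KG ψ b 1).re| := by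
    conv_lhs => rw [hreal ψ]
    rw [Complex.norm_real, Real.norm_eq_abs]
  by_contra! hcon
  have hgt : 4 * (p : ℝ) < (KG ψ b 1).re ^ 2 := by
    rw [← sq_abs, ← hnn]
    have h1 : (2 * Real.sqrt p) ^ 2 = 4 * p := by
      rw [mul_pow, Real.sq_sqrt hp0.le]; norm_num
    rw [← h1]
    exact pow_lt_pow_left₀ hcon (by positivity) (by norm_num)
  obtain ⟨l, hl, hlm⟩ := (hsb ψ hψ).2 hgt
  have hmain : ∀ m : ℕ, 2 ≤ m → l ^ (m + 1) ≤ 12 * p * (p : ℝ) ^ (m + 1) := by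
    intro m hm
    letI := Fintype.ofFinite (GaloisField p (2 * (m + 1)))
    letI := Classical.decEq (GaloisField p (2 * (m + 1)))
    have hKG : ∀ φ : AddChar (ZMod p) ℂ,
      KE φ b (GaloisField p (2 * (m + 1))) = KG φ b (2 * (m + 1)) := fun φ => rfl
    have hc : Fintype.card (GaloisField p (2 * (m + 1))) = (p ^ (m + 1)) ^ 2 := by
      rw [← Nat.card_eq_fintype_card, GaloisField.card p _ (by omega), ← pow_mul]
      ring_nf
    have h1 := sum_KE_lower (E := GaloisField p (2 * (m + 1))) hp2 b hb (m + 1) (by omega) hc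
    have hmem : ψ ∈ (univ : Finset (AddChar (ZMod p) ℂ)).erase 1 := by simp [hψ]
    rw [← Finset.add_sum_erase _ _ hmem] at h1
    have h2 : ∑ φ ∈ ((univ : Finset (AddChar (ZMod p) ℂ)).erase 1).erase ψ,
        (KE φ b (GaloisField p (2 * (m + 1)))).re ≤
        ∑ φ ∈ ((univ : Finset (AddChar (ZMod p) ℂ)).erase 1).erase ψ, 2 * (p : ℝ) ^ (m + 1) := by
      refine Finset.sum_le_sum fun φ hφ => ?_
      have hφ1 : φ ≠ 1 := (mem_erase.1 (mem_erase.1 hφ).2).1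
      rw [hKG]
      exact (hsb φ hφ1).1 m
    have h3 : (KE ψ b (GaloisField p (2 * (m + 1)))).re ≤ - l ^ (m + 1) := by
      rw [hKG]
      exact hlm m
    rw [Finset.sum_const, nsmul_eq_mul] at h2
    have h4 : ((((univ : Finset (AddChar (ZMod p) ℂ)).erase 1).erase ψ).card : ℝ) ≤ p := by
      have : (((univ : Finset (AddChar (ZMod p) ℂ)).erase 1).erase ψ).card ≤
        Fintype.card (AddChar (ZMod p) ℂ) := Finset.card_le_univ _
      rw [AddChar.card_eq, ZMod.card] at this
      exact_mod_cast this
    have h5 : (0:ℝ) ≤ 2 * (p : ℝ) ^ (m + 1) := by positivity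
    nlinarith [mul_le_mul_of_nonneg_right h4 h5]
  have hr : 1 < l / p := (one_lt_div hp0).2 hl
  obtain ⟨n, hn⟩ := pow_unbounded_of_one_lt (12 * p : ℝ) hr
  have h6 := hmain (n + 2) (by omega)
  have h7 : (l / p) ^ (n + 3) ≤ 12 * p := by
    rw [div_pow, div_le_iff₀ (by positivity)]
    exact h6
  have h8 : (l / p) ^ n ≤ (l / p) ^ (n + 3) := pow_le_pow_right₀ hr.le (by omega)
  linarith

theorem weil_all (ψ : AddChar (ZMod p) ℂ) (hψ : ψ ≠ 1) (b : ZMod p) (hb : b ≠ 0) :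
    ‖∑ x : ZMod p, if x = 0 then 0 else ψ (x + b * x⁻¹)‖ ≤ 2 * Real.sqrt p := by
  by_cases hp2 : p = 2
  · subst hp2
    refine (norm_sum_le _ _).trans ?_
    have : ∀ x : ZMod 2, ‖if x = 0 then (0 : ℂ) else ψ (x + b * x⁻¹)‖ ≤ 1 := by
      intro x
      split_ifs <;> simp
    refine (Finset.sum_le_sum fun x _ => this x).trans ?_
    have h1 : (1:ℝ) ≤ Real.sqrt (2 : ℕ) := by
      rw [Real.one_le_sqrt]; norm_num
    simp only [sum_const, card_univ, ZMod.card, nsmul_eq_mul]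
    push_cast at h1 ⊢
    linarith
  · exact weil_odd hp2 ψ hψ b hb

end KloostermanWeil2

section KloostermanCorr
open Finset

variable {q : ℕ} [Fact q.Prime]

lemma weil_two (ψ : AddChar (ZMod q) ℂ) (hψ : ψ ≠ 1) (A B : ZMod q) (hA : A ≠ 0) (hB : B ≠ 0) :
    ‖∑ x : ZMod q, if x = 0 then 0 else ψ (A * x + B * x⁻¹)‖ ≤ 2 * Real.sqrt q := by
  refine le_trans (le_of_eq ?_) (weil_all ψ hψ (A * B) (mul_ne_zero hA hB))
  congr 1
  refine Fintype.sum_equiv (Equiv.mulLeft₀ A hA) _ _ fun x => ?_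
  by_cases hx : x = 0
  · simp [hx]
  · simp only [Equiv.mulLeft₀_apply, hx, mul_eq_zero, hA, or_self, if_false]
    congr 2
    field_simp

lemma sum_char_eq (ψ : AddChar (ZMod q) ℂ) (hψ : ψ ≠ 1) (t : ZMod q) :
    ∑ x : ZMod q, ψ (t * x) = if t = 0 then (q : ℂ) else 0 := by
  have := AddChar.sum_mulShift t (AddChar.IsPrimitive.of_ne_one hψ)
  simp only [ZMod.card] at this
  simpa [mul_comm] using this

lemma sum_char_ne (ψ : AddChar (ZMod q) ℂ) (hψ : ψ ≠ 1) (t : ZMod q) (ht : t ≠ 0) :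
    (∑ x : ZMod q, if x = 0 then 0 else ψ (t * x)) = -1 := by
  have h := sum_char_eq ψ hψ t
  rw [if_neg ht] at h
  have h2 : ∀ x : ZMod q, (if x = 0 then 0 else ψ (t * x)) = ψ (t * x) - if x = 0 then 1 else 0 := by
    intro x
    split_ifs with hx
    · simp [hx]
    · simp
  simp_rw [h2, Finset.sum_sub_distrib, h]
  simp

noncomputable def KU (ψ : AddChar (ZMod q) ℂ) (x : ZMod q) : ℂ :=
  ∑ u : ZMod q, if u = 0 then 0 else ψ (x * u⁻¹ + u)

lemma KU_norm (ψ : AddChar (ZMod q) ℂ) (hψ : ψ ≠ 1) (x : ZMod q) :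
    ‖KU ψ x‖ ≤ 2 * Real.sqrt q := by
  unfold KU
  by_cases hx : x = 0
  · have := sum_char_ne ψ hψ 1 one_ne_zero
    simp only [one_mul] at this
    simp only [hx, zero_mul, zero_add, this]
    have hq : (1 : ℝ) ≤ q := by exact_mod_cast (Fact.out : q.Prime).one_lt.le
    have : 1 ≤ Real.sqrt q := Real.one_le_sqrt.2 hq
    simp
    linarith
  · have := weil_two ψ hψ 1 x one_ne_zero hx
    simpa [add_comm] using this

lemma KU_conj (ψ : AddChar (ZMod q) ℂ) (x : ZMod q) :
    (starRingEnd ℂ) (KU ψ x) = KU ψ x := by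
  unfold KU
  rw [map_sum, ← Equiv.sum_comp (Equiv.neg (ZMod q))]
  refine Finset.sum_congr rfl fun u _ => ?_
  by_cases hu : u = 0
  · simp [hu]
  · simp only [Equiv.neg_apply, neg_eq_zero, hu, if_false, inv_neg, mul_neg]
    rw [← neg_add, AddChar.map_neg_eq_conj, Complex.conj_conj]

lemma Kl_eq_KU (x : ZMod q) : Kl q x = ((Real.sqrt q)⁻¹ : ℝ) * KU (ZMod.stdAddChar (N := q)) x := by
  have he : ∀ y : ZMod q, eChar q y = ZMod.stdAddChar y := by
    intro y
    rw [ZMod.stdAddChar_apply, ZMod.toCircle_apply, eChar]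
  unfold Kl KU
  congr 1
  have h1 : (∑ u : ZMod q, if u = 0 then (0 : ℂ) else ZMod.stdAddChar (x * u⁻¹ + u)) =
      ∑ u ∈ univ.filter (fun u : ZMod q => u ≠ 0), ZMod.stdAddChar (x * u⁻¹ + u) := by
    rw [Finset.sum_filter]
    refine Finset.sum_congr rfl fun u _ => ?_
    by_cases hu : u = 0 <;> simp [hu]
  rw [h1]
  refine Finset.sum_bij (fun d _ => ((d⁻¹ : (ZMod q)ˣ) : ZMod q)) ?_ ?_ ?_ ?_
  · intro d _
    exact mem_filter.2 ⟨mem_univ _, Units.ne_zero _⟩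
  · intro d _ d' _ h
    exact inv_injective (Units.ext h)
  · intro u hu
    have hu0 : u ≠ 0 := (mem_filter.1 hu).2
    exact ⟨(Units.mk0 u hu0)⁻¹, mem_univ _, by simp⟩
  · intro d _
    rw [he, Units.val_inv_eq_inv_val, inv_inv]

noncomputable def TU (ψ : AddChar (ZMod q) ℂ) (c₁ c₂ h : ZMod q) : ℂ :=
  ∑ u : ZMod q, ∑ w : ZMod q,
    if u ≠ 0 ∧ w ≠ 0 ∧ c₁ * w + c₂ * u + h * u * w = 0 then ψ (u + w) else 0

lemma TU_comm (ψ : AddChar (ZMod q) ℂ) (c₁ c₂ h : ZMod q) : TU ψ c₁ c₂ h = TU ψ c₂ c₁ h := by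
  unfold TU
  rw [Finset.sum_comm]
  refine Finset.sum_congr rfl fun u _ => Finset.sum_congr rfl fun w _ => ?_
  rw [add_comm w u]
  congr 1
  rw [eq_iff_iff]
  constructor
  · rintro ⟨h1, h2, h3⟩
    exact ⟨h2, h1, by linear_combination h3⟩
  · rintro ⟨h1, h2, h3⟩
    exact ⟨h2, h1, by linear_combination h3⟩

lemma TU_bound_aux (ψ : AddChar (ZMod q) ℂ) (hψ : ψ ≠ 1) (c₁ c₂ h : ZMod q) (hc : c₁ ≠ c₂)
    (hc2 : c₂ ≠ 0) : ‖TU ψ c₁ c₂ h‖ ≤ 3 * Real.sqrt q := by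
  have hq : (1 : ℝ) ≤ q := by exact_mod_cast (Fact.out : q.Prime).one_lt.le
  have hs : 1 ≤ Real.sqrt q := Real.one_le_sqrt.2 hq
  have hT : TU ψ c₁ c₂ h = ∑ u : ZMod q, if u ≠ 0 ∧ c₁ + h * u ≠ 0 then
      ψ (u - c₂ * u * (c₁ + h * u)⁻¹) else 0 := by
    unfold TU
    refine Finset.sum_congr rfl fun u _ => ?_
    split_ifs with hu
    · rw [Finset.sum_eq_single (-(c₂ * u * (c₁ + h * u)⁻¹))]
      · rw [if_pos, sub_eq_add_neg]
        refine ⟨hu.1, neg_ne_zero.2 (mul_ne_zero (mul_ne_zero hc2 hu.1) (inv_ne_zero hu.2)), ?_⟩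
        have := mul_inv_cancel₀ hu.2
        linear_combination (-c₂ * u) * this
      · intro w _ hw
        rw [if_neg]
        rintro ⟨h1, h2, h3⟩
        apply hw
        rw [eq_comm, neg_eq_iff_eq_neg, ← div_eq_mul_inv, div_eq_iff hu.2]
        linear_combination h3
      · simp
    · refine Finset.sum_eq_zero fun w _ => ?_
      rw [if_neg]
      rintro ⟨h1, h2, h3⟩
      apply hu
      refine ⟨h1, fun h4 => ?_⟩
      exact mul_ne_zero hc2 h1 (by linear_combination h3 - w * h4)
  rw [hT]
  by_cases hh : h = 0
  · subst hh
    by_cases h1 : c₁ = 0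
    · simp [h1]
    · have := sum_char_ne ψ hψ (1 - c₂ * c₁⁻¹) (by
        rw [sub_ne_zero]
        intro h2
        apply hc
        field_simp at h2
        exact h2)
      have h3 : (∑ u : ZMod q, if u ≠ 0 ∧ c₁ + 0 * u ≠ 0 then
        ψ (u - c₂ * u * (c₁ + 0 * u)⁻¹) else 0) = -1 := by
        rw [← this]
        refine Finset.sum_congr rfl fun u _ => ?_
        by_cases hu : u = 0
        · simp [hu]
        · simp only [ne_eq, hu, not_false_eq_true, zero_mul, add_zero, h1, and_self, if_true,
            if_false]
          congr 1
          ring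
      rw [h3]
      simp
      linarith
  · have hT2 : (∑ u : ZMod q, if u ≠ 0 ∧ c₁ + h * u ≠ 0 then
      ψ (u - c₂ * u * (c₁ + h * u)⁻¹) else 0) = ψ (-((c₁ + c₂) * h⁻¹)) *
        ∑ v : ZMod q, if v ≠ 0 ∧ v ≠ c₁ then ψ (h⁻¹ * v + (c₁ * c₂ * h⁻¹) * v⁻¹) else 0 := by
      rw [Finset.mul_sum]
      refine Fintype.sum_equiv ((Equiv.mulLeft₀ h hh).trans (Equiv.addLeft c₁)) _ _ fun u => ?_
      simp only [Equiv.trans_apply, Equiv.mulLeft₀_apply, Equiv.coe_addLeft]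
      by_cases hu : u ≠ 0 ∧ c₁ + h * u ≠ 0
      · rw [if_pos hu, if_pos ⟨hu.2, by simpa [hh] using hu.1⟩, ← AddChar.map_add_eq_mul]
        congr 1
        have hi := mul_inv_cancel₀ hu.2
        have hj := mul_inv_cancel₀ hh
        linear_combination (-u + c₂ * u * (c₁ + h * u)⁻¹) * hj + (-c₂ * h⁻¹) * hi
      · rw [if_neg hu, if_neg, mul_zero]
        rintro ⟨h1, h2⟩
        exact hu ⟨by simpa [hh] using h2, h1⟩
    rw [hT2, norm_mul, AddChar.norm_apply, one_mul]
    by_cases h1 : c₁ = 0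
    · have := sum_char_ne ψ hψ h⁻¹ (inv_ne_zero hh)
      have h3 : (∑ v : ZMod q, if v ≠ 0 ∧ v ≠ c₁ then ψ (h⁻¹ * v + (c₁ * c₂ * h⁻¹) * v⁻¹) else 0)
          = -1 := by
        rw [← this]
        refine Finset.sum_congr rfl fun u _ => ?_
        by_cases hu : u = 0 <;> simp [hu, h1]
      rw [h3]; simp; linarith
    · have h3 : (∑ v : ZMod q, if v ≠ 0 ∧ v ≠ c₁ then ψ (h⁻¹ * v + (c₁ * c₂ * h⁻¹) * v⁻¹) else 0)
          = (∑ v : ZMod q, if v = 0 then 0 else ψ (h⁻¹ * v + (c₁ * c₂ * h⁻¹) * v⁻¹)) -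
            ψ (h⁻¹ * c₁ + (c₁ * c₂ * h⁻¹) * c₁⁻¹) := by
        have : ψ (h⁻¹ * c₁ + (c₁ * c₂ * h⁻¹) * c₁⁻¹) = ∑ v : ZMod q, if v = c₁ then
          ψ (h⁻¹ * v + (c₁ * c₂ * h⁻¹) * v⁻¹) else 0 := by simp
        rw [this, ← Finset.sum_sub_distrib]
        refine Finset.sum_congr rfl fun v _ => ?_
        by_cases hv : v = 0
        · simp [hv, Ne.symm h1]
        · by_cases hv1 : v = c₁
          · simp [hv1, h1]
          · simp [hv, hv1]
      rw [h3]
      refine (norm_sub_le _ _).trans ?_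
      rw [AddChar.norm_apply]
      have := weil_two ψ hψ h⁻¹ (c₁ * c₂ * h⁻¹) (inv_ne_zero hh)
        (mul_ne_zero (mul_ne_zero h1 hc2) (inv_ne_zero hh))
      linarith

lemma TU_bound (ψ : AddChar (ZMod q) ℂ) (hψ : ψ ≠ 1) (c₁ c₂ h : ZMod q) (hc : c₁ ≠ c₂) :
    ‖TU ψ c₁ c₂ h‖ ≤ 3 * Real.sqrt q := by
  by_cases hc2 : c₂ = 0
  · rw [TU_comm]
    exact TU_bound_aux ψ hψ c₂ c₁ h hc.symm (by rw [← hc2]; exact hc)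
  · exact TU_bound_aux ψ hψ c₁ c₂ h hc hc2

lemma corr_eq (ψ : AddChar (ZMod q) ℂ) (hψ : ψ ≠ 1) (c₁ c₂ h : ZMod q) :
    ∑ x : ZMod q, KU ψ (c₁ * x) * KU ψ (c₂ * x) * ψ (h * x) = q * TU ψ c₁ c₂ h := by
  unfold KU TU
  simp_rw [Finset.sum_mul_sum, Finset.sum_mul, Finset.mul_sum]
  rw [Finset.sum_comm]
  refine Finset.sum_congr rfl fun u _ => ?_
  rw [Finset.sum_comm]
  refine Finset.sum_congr rfl fun w _ => ?_
  by_cases hu : u = 0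
  · simp [hu]
  by_cases hw : w = 0
  · simp [hw]
  simp only [hu, hw, if_false, ne_eq, not_false_eq_true, true_and]
  have h1 : ∀ x : ZMod q, ψ (c₁ * x * u⁻¹ + u) * ψ (c₂ * x * w⁻¹ + w) * ψ (h * x) =
      ψ (u + w) * ψ ((c₁ * u⁻¹ + c₂ * w⁻¹ + h) * x) := by
    intro x
    rw [← AddChar.map_add_eq_mul, ← AddChar.map_add_eq_mul, ← AddChar.map_add_eq_mul]
    congr 1; ring
  simp_rw [h1, ← Finset.mul_sum, sum_char_eq ψ hψ]
  have h2 : c₁ * u⁻¹ + c₂ * w⁻¹ + h = 0 ↔ c₁ * w + c₂ * u + h * u * w = 0 := by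
    have : c₁ * u⁻¹ + c₂ * w⁻¹ + h = (c₁ * w + c₂ * u + h * u * w) / (u * w) := by
      field_simp
    rw [this, div_eq_zero_iff]
    simp [hu, hw]
  by_cases h3 : c₁ * w + c₂ * u + h * u * w = 0
  · rw [if_pos (h2.2 h3), if_pos h3, mul_comm]
  · simp [mt h2.1 h3, h3]

end KloostermanCorr

section KloostermanBil
open Finset

variable {q : ℕ} [Fact q.Prime]

lemma card_congr_le (R u : ℕ) (hR : R ≤ 4 * q) :
    ((range R).filter (fun v : ℕ => (v : ZMod q) = (u : ZMod q))).card ≤ 5 := by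
  have hq : 0 < q := (Fact.out : q.Prime).pos
  rw [← card_range 5]
  refine Finset.card_le_card_of_injOn (fun v => v / q) ?_ ?_
  · intro v hv
    have hv' := mem_filter.1 hv
    have h1 := mem_range.1 hv'.1
    simp only [coe_range, Set.mem_Iio]
    rw [Nat.div_lt_iff_lt_mul hq]
    omega
  · intro v hv v' hv' h
    have h1 := (mem_filter.1 hv).2
    have h2 := (mem_filter.1 hv').2
    have h3 : v % q = v' % q := (ZMod.natCast_eq_natCast_iff' _ _ _).1 (h1.trans h2.symm)
    simp only at h
    rw [← Nat.div_add_mod v q, ← Nat.div_add_mod v' q, h, h3]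

noncomputable def ES (ψ : AddChar (ZMod q) ℂ) (R : ℕ) (h : ZMod q) : ℂ :=
  ∑ u ∈ range R, ψ (h * u)

lemma ES_sq (ψ : AddChar (ZMod q) ℂ) (R : ℕ) (h : ZMod q) :
    ((‖ES ψ R h‖ ^ 2 : ℝ) : ℂ) = ∑ u ∈ range R, ∑ v ∈ range R, ψ (h * ((u : ZMod q) - v)) := by
  push_cast
  rw [← Complex.mul_conj', ES, map_sum, Finset.sum_mul_sum]
  refine Finset.sum_congr rfl fun u _ => Finset.sum_congr rfl fun v _ => ?_
  rw [← AddChar.map_neg_eq_conj, ← AddChar.map_add_eq_mul]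
  congr 1; ring

lemma ES_total (ψ : AddChar (ZMod q) ℂ) (hψ : ψ ≠ 1) (R : ℕ) (hR : R ≤ 4 * q) :
    ∑ h : ZMod q, ‖ES ψ R h‖ ^ 2 ≤ q * (5 * R) := by
  have h1 : ((∑ h : ZMod q, ‖ES ψ R h‖ ^ 2 : ℝ) : ℂ) =
      ((q * (∑ u ∈ range R,
        ((range R).filter (fun v : ℕ => (v : ZMod q) = (u : ZMod q))).card) : ℕ) : ℂ) := by
    rw [Complex.ofReal_sum]
    simp_rw [ES_sq]
    rw [Finset.sum_comm]
    push_cast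
    rw [Finset.mul_sum]
    refine Finset.sum_congr rfl fun u _ => ?_
    rw [Finset.sum_comm, Finset.card_filter, Nat.cast_sum, Finset.mul_sum]
    refine Finset.sum_congr rfl fun v _ => ?_
    simp_rw [mul_comm _ ((u : ZMod q) - v)]
    rw [sum_char_eq ψ hψ]
    by_cases huv : (v : ZMod q) = u
    · simp [huv]
    · rw [if_neg (sub_ne_zero.2 (Ne.symm huv)), if_neg huv]; simp
  have h2 : (∑ h : ZMod q, ‖ES ψ R h‖ ^ 2 : ℝ) = ((q * (∑ u ∈ range R,
        ((range R).filter (fun v : ℕ => (v : ZMod q) = (u : ZMod q))).card) : ℕ) : ℝ) := by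
    exact_mod_cast h1
  rw [h2]
  have h3 : ∑ u ∈ range R, ((range R).filter (fun v : ℕ => (v : ZMod q) = (u : ZMod q))).card ≤
      5 * R := by
    refine (Finset.sum_le_sum fun u _ => card_congr_le (q := q) R u hR).trans ?_
    simp [mul_comm]
  exact_mod_cast Nat.mul_le_mul_left q h3

lemma completion (ψ : AddChar (ZMod q) ℂ) (hψ : ψ ≠ 1) (f : ZMod q → ℂ) (B : ℝ)
    (hB : ∀ h, ‖∑ x, f x * ψ (h * x)‖ ≤ B) (R : ℕ) (hR : R ≤ 4 * q) (n₀ : ZMod q) :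
    ‖∑ u ∈ range R, ∑ v ∈ range R, f (n₀ + ((u : ZMod q) - v))‖ ≤ B * (5 * R) := by
  have hq : (0 : ℝ) < q := by exact_mod_cast (Fact.out : q.Prime).pos
  have hinv : ∀ y, (q : ℂ) * f y = ∑ h : ZMod q, (∑ x, f x * ψ (h * x)) * ψ (-(h * y)) := by
    intro y
    simp_rw [Finset.sum_mul]
    rw [Finset.sum_comm]
    have : ∀ x, ∑ h : ZMod q, f x * ψ (h * x) * ψ (-(h * y)) =
        if x = y then (q : ℂ) * f x else 0 := by
      intro x
      have h1 : ∀ h : ZMod q, f x * ψ (h * x) * ψ (-(h * y)) = f x * ψ ((x - y) * h) := by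
        intro h
        rw [mul_assoc, ← AddChar.map_add_eq_mul]
        congr 2; ring
      simp_rw [h1]
      rw [← Finset.mul_sum, sum_char_eq ψ hψ]
      by_cases hxy : x = y
      · simp [hxy, mul_comm]
      · rw [if_neg (sub_ne_zero.2 hxy), if_neg hxy, mul_zero]
    simp_rw [this]
    simp
  have hkey : (q : ℂ) * ∑ u ∈ range R, ∑ v ∈ range R, f (n₀ + ((u : ZMod q) - v)) =
      ∑ h : ZMod q, (∑ x, f x * ψ (h * x)) * (ψ (-(h * n₀)) * ((‖ES ψ R (-h)‖ ^ 2 : ℝ) : ℂ)) := by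
    simp_rw [Finset.mul_sum, hinv]
    have : ∀ h : ZMod q, (∑ x, f x * ψ (h * x)) * (ψ (-(h * n₀)) * ((‖ES ψ R (-h)‖ ^ 2 : ℝ) : ℂ)) =
        ∑ u ∈ range R, ∑ v ∈ range R,
          (∑ x, f x * ψ (h * x)) * ψ (-(h * (n₀ + ((u : ZMod q) - v)))) := by
      intro h
      rw [ES_sq]
      simp_rw [Finset.mul_sum]
      refine Finset.sum_congr rfl fun u _ => Finset.sum_congr rfl fun v _ => ?_
      rw [← AddChar.map_add_eq_mul]
      congr 2; ring
    simp_rw [this]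
    symm
    rw [Finset.sum_comm]
    refine Finset.sum_congr rfl fun u _ => ?_
    rw [Finset.sum_comm]
  have hn := congrArg norm hkey
  rw [norm_mul, Complex.norm_natCast] at hn
  have h2 : (q : ℝ) * ‖∑ u ∈ range R, ∑ v ∈ range R, f (n₀ + ((u : ZMod q) - v))‖ ≤
      q * (B * (5 * R)) := by
    rw [hn]
    refine (norm_sum_le _ _).trans ?_
    have h3 : ∀ h : ZMod q, ‖(∑ x, f x * ψ (h * x)) *
        (ψ (-(h * n₀)) * ((‖ES ψ R (-h)‖ ^ 2 : ℝ) : ℂ))‖ ≤ B * ‖ES ψ R (-h)‖ ^ 2 := by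
      intro h
      rw [norm_mul, norm_mul, AddChar.norm_apply, one_mul, Complex.norm_real, Real.norm_eq_abs,
        abs_of_nonneg (by positivity)]
      exact mul_le_mul_of_nonneg_right (hB h) (by positivity)
    refine (Finset.sum_le_sum fun h _ => h3 h).trans ?_
    rw [← Finset.mul_sum, Fintype.sum_equiv (Equiv.neg (ZMod q)) (fun h => ‖ES ψ R (-h)‖ ^ 2)
      (fun h => ‖ES ψ R h‖ ^ 2) (fun h => rfl)]
    have hB0 : 0 ≤ B := (norm_nonneg _).trans (hB 0)
    refine (mul_le_mul_of_nonneg_left (ES_total ψ hψ R hR) hB0).trans (le_of_eq (by ring))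
  exact le_of_mul_le_mul_left h2 hq

lemma fejer (G : ZMod q → ℝ) (hG : ∀ x, 0 ≤ G x) (L : ℕ) (n₀ : ZMod q) :
    L * ∑ i ∈ range L, G (n₀ + i) ≤
      ∑ u ∈ range (2 * L), ∑ v ∈ range (2 * L), G (n₀ + ((u : ZMod q) - v)) := by
  rw [Finset.sum_comm]
  have h1 : ∀ v ∈ range L, ∑ i ∈ range L, G (n₀ + i) ≤
      ∑ u ∈ range (2 * L), G (n₀ + ((u : ZMod q) - v)) := by
    intro v hv
    have hv' := mem_range.1 hv
    have h2 : ∑ i ∈ range L, G (n₀ + i) = ∑ u ∈ Ico v (v + L), G (n₀ + ((u : ZMod q) - v)) := by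
      rw [Finset.sum_Ico_eq_sum_range]
      simp
    rw [h2]
    refine Finset.sum_le_sum_of_subset_of_nonneg ?_ fun _ _ _ => hG _
    intro u hu
    rw [mem_Ico] at hu
    rw [mem_range]
    omega
  calc L * ∑ i ∈ range L, G (n₀ + i) = ∑ v ∈ range L, ∑ i ∈ range L, G (n₀ + i) := by simp
    _ ≤ ∑ v ∈ range L, ∑ u ∈ range (2 * L), G (n₀ + ((u : ZMod q) - v)) := Finset.sum_le_sum h1
    _ ≤ _ := by
      refine Finset.sum_le_sum_of_subset_of_nonneg (range_subset_range.2 (by omega)) fun _ _ _ => ?_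
      exact Finset.sum_nonneg fun _ _ => hG _

lemma std_ne_one : (ZMod.stdAddChar (N := q)) ≠ 1 := by
  have : Fact (1 < q) := ⟨(Fact.out : q.Prime).one_lt⟩
  intro h
  have h1 : ZMod.stdAddChar (N := q) 1 = ZMod.stdAddChar (N := q) 0 := by rw [h]; simp
  exact one_ne_zero (ZMod.injective_stdAddChar h1)

lemma Kl_norm (x : ZMod q) : ‖Kl q x‖ ≤ 2 := by
  have hq : (0 : ℝ) < q := by exact_mod_cast (Fact.out : q.Prime).pos
  have hs : 0 < Real.sqrt q := Real.sqrt_pos.2 hq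
  rw [Kl_eq_KU, norm_mul, Complex.norm_real, Real.norm_eq_abs, abs_of_nonneg (by positivity),
    inv_mul_le_iff₀ hs, mul_comm]
  exact KU_norm _ std_ne_one x

lemma Kl_conj (x : ZMod q) : (starRingEnd ℂ) (Kl q x) = Kl q x := by
  rw [Kl_eq_KU, map_mul, KU_conj, Complex.conj_ofReal]

lemma Kl_corr (c₁ c₂ h : ZMod q) (hc : c₁ ≠ c₂) :
    ‖∑ x : ZMod q, (Kl q (c₁ * x) * Kl q (c₂ * x)) * ZMod.stdAddChar (h * x)‖ ≤
      3 * Real.sqrt q := by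
  have hq : (0 : ℝ) < q := by exact_mod_cast (Fact.out : q.Prime).pos
  have hs : 0 < Real.sqrt q := Real.sqrt_pos.2 hq
  have h1 : ∑ x : ZMod q, (Kl q (c₁ * x) * Kl q (c₂ * x)) * ZMod.stdAddChar (h * x) =
      TU (ZMod.stdAddChar (N := q)) c₁ c₂ h := by
    have h2 := corr_eq (ZMod.stdAddChar (N := q)) std_ne_one c₁ c₂ h
    have h3 : ((((Real.sqrt q)⁻¹ : ℝ) : ℂ)) * ((Real.sqrt q)⁻¹ : ℝ) * (q : ℂ) = 1 := by
      have : (Real.sqrt q)⁻¹ * (Real.sqrt q)⁻¹ * (q : ℝ) = 1 := by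
        rw [← mul_inv, Real.mul_self_sqrt hq.le, inv_mul_cancel₀ hq.ne']
      exact_mod_cast this
    calc _ = ((((Real.sqrt q)⁻¹ : ℝ) : ℂ)) * ((Real.sqrt q)⁻¹ : ℝ) *
          ∑ x : ZMod q, KU (ZMod.stdAddChar (N := q)) (c₁ * x) *
            KU (ZMod.stdAddChar (N := q)) (c₂ * x) * ZMod.stdAddChar (h * x) := by
          rw [Finset.mul_sum]
          refine Finset.sum_congr rfl fun x _ => ?_
          rw [Kl_eq_KU, Kl_eq_KU]; ring
      _ = _ := by rw [h2, ← mul_assoc, h3, one_mul]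
  rw [h1]
  exact TU_bound _ std_ne_one c₁ c₂ h hc

lemma bil_g (c : ℕ → ZMod q) (S : Finset ℕ)
    (hS : ∀ m₁ ∈ S, ∀ m₂ ∈ S, m₁ ≠ m₂ → c m₁ ≠ c m₂) (L : ℕ) (hL0 : 0 < L) (hL : 2 * L ≤ 4 * q)
    (n₀ : ZMod q) (α : ℕ → ℂ) :
    ∑ i ∈ range L, ‖∑ m ∈ S, α m * Kl q (c m * (n₀ + i))‖ ^ 2 ≤
      (∑ m ∈ S, ‖α m‖ ^ 2) * (16 * L + 30 * Real.sqrt q * S.card) := by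
  have hs : 0 ≤ Real.sqrt q := Real.sqrt_nonneg _
  set g : ZMod q → ℂ := fun x => ∑ m ∈ S, α m * Kl q (c m * x) with hg
  have hf := fejer (fun x => ‖g x‖ ^ 2) (fun x => by positivity) L n₀
  set D : ℕ → ℕ → ℂ := fun m₁ m₂ => ∑ u ∈ range (2 * L), ∑ v ∈ range (2 * L),
    (Kl q (c m₁ * (n₀ + ((u : ZMod q) - v))) * Kl q (c m₂ * (n₀ + ((u : ZMod q) - v)))) with hD
  have hDd : ∀ m₁ m₂, ‖D m₁ m₂‖ ≤ 16 * (L : ℝ) ^ 2 := by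
    intro m₁ m₂
    have h1 : ∀ x y : ZMod q, ‖Kl q x * Kl q y‖ ≤ 4 := by
      intro x y
      rw [norm_mul]
      nlinarith [Kl_norm x, Kl_norm y, norm_nonneg (Kl q x), norm_nonneg (Kl q y)]
    refine (norm_sum_le _ _).trans ?_
    refine (Finset.sum_le_sum fun u _ => (norm_sum_le _ _).trans
      (Finset.sum_le_sum fun v _ => h1 _ _)).trans (le_of_eq ?_)
    simp
    ring
  have hDo : ∀ m₁ ∈ S, ∀ m₂ ∈ S, m₁ ≠ m₂ → ‖D m₁ m₂‖ ≤ 30 * L * Real.sqrt q := by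
    intro m₁ h₁ m₂ h₂ hne
    have := completion (ZMod.stdAddChar (N := q)) std_ne_one
      (fun x => Kl q (c m₁ * x) * Kl q (c m₂ * x)) (3 * Real.sqrt q)
      (fun h => Kl_corr _ _ h (hS m₁ h₁ m₂ h₂ hne)) (2 * L) hL n₀
    refine this.trans (le_of_eq ?_)
    push_cast; ring
  have hsum : ((∑ u ∈ range (2 * L), ∑ v ∈ range (2 * L),
      ‖g (n₀ + ((u : ZMod q) - v))‖ ^ 2 : ℝ) : ℂ) =
      ∑ m₁ ∈ S, ∑ m₂ ∈ S, α m₁ * (starRingEnd ℂ) (α m₂) * D m₁ m₂ := by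
    have hx : ∀ x, ((‖g x‖ ^ 2 : ℝ) : ℂ) = ∑ m₁ ∈ S, ∑ m₂ ∈ S,
        α m₁ * (starRingEnd ℂ) (α m₂) * (Kl q (c m₁ * x) * Kl q (c m₂ * x)) := by
      intro x
      push_cast
      rw [← Complex.mul_conj', hg, map_sum, Finset.sum_mul_sum]
      refine Finset.sum_congr rfl fun u _ => Finset.sum_congr rfl fun v _ => ?_
      rw [map_mul, Kl_conj]; ring
    rw [Complex.ofReal_sum]
    simp_rw [Complex.ofReal_sum, hx, hD, Finset.mul_sum]
    have e1 : ∀ u ∈ range (2 * L), (∑ v ∈ range (2 * L), ∑ m₁ ∈ S, ∑ m₂ ∈ S,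
        α m₁ * (starRingEnd ℂ) (α m₂) * (Kl q (c m₁ * (n₀ + ((u : ZMod q) - v))) *
          Kl q (c m₂ * (n₀ + ((u : ZMod q) - v))))) =
        ∑ m₁ ∈ S, ∑ m₂ ∈ S, ∑ v ∈ range (2 * L),
        α m₁ * (starRingEnd ℂ) (α m₂) * (Kl q (c m₁ * (n₀ + ((u : ZMod q) - v))) *
          Kl q (c m₂ * (n₀ + ((u : ZMod q) - v)))) := by
      intro u _
      rw [Finset.sum_comm]
      exact Finset.sum_congr rfl fun m₁ _ => Finset.sum_comm
    rw [Finset.sum_congr rfl e1, Finset.sum_comm]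
    exact Finset.sum_congr rfl fun m₁ _ => Finset.sum_comm
  have hbound : (∑ u ∈ range (2 * L), ∑ v ∈ range (2 * L),
      ‖g (n₀ + ((u : ZMod q) - v))‖ ^ 2 : ℝ) ≤
      16 * (L : ℝ) ^ 2 * ∑ m ∈ S, ‖α m‖ ^ 2 + 30 * L * Real.sqrt q * (∑ m ∈ S, ‖α m‖) ^ 2 := by
    have h0 : (∑ u ∈ range (2 * L), ∑ v ∈ range (2 * L),
      ‖g (n₀ + ((u : ZMod q) - v))‖ ^ 2 : ℝ) = ‖((∑ u ∈ range (2 * L), ∑ v ∈ range (2 * L),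
      ‖g (n₀ + ((u : ZMod q) - v))‖ ^ 2 : ℝ) : ℂ)‖ := by
      rw [Complex.norm_real, Real.norm_eq_abs, abs_of_nonneg]
      exact Finset.sum_nonneg fun _ _ => Finset.sum_nonneg fun _ _ => by positivity
    rw [h0, hsum]
    have h1 : ∀ m₁ ∈ S, ∀ m₂ ∈ S, ‖α m₁ * (starRingEnd ℂ) (α m₂) * D m₁ m₂‖ ≤
        (if m₁ = m₂ then 16 * (L : ℝ) ^ 2 * ‖α m₁‖ ^ 2 else 0) +
          30 * L * Real.sqrt q * (‖α m₁‖ * ‖α m₂‖) := by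
      intro m₁ h₁ m₂ h₂
      rw [norm_mul, norm_mul, RCLike.norm_conj]
      have ha : 0 ≤ ‖α m₁‖ * ‖α m₂‖ := by positivity
      by_cases hm : m₁ = m₂
      · subst hm
        rw [if_pos rfl]
        have hh := mul_le_mul_of_nonneg_left (hDd m₁ m₁) ha
        have : 0 ≤ 30 * L * Real.sqrt q * (‖α m₁‖ * ‖α m₁‖) := by positivity
        nlinarith
      · rw [if_neg hm, zero_add]
        have hh := mul_le_mul_of_nonneg_left (hDo m₁ h₁ m₂ h₂ hm) ha
        linarith
    refine (norm_sum_le _ _).trans ?_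
    refine (Finset.sum_le_sum fun m₁ h₁ => (norm_sum_le _ _).trans
      (Finset.sum_le_sum fun m₂ h₂ => h1 m₁ h₁ m₂ h₂)).trans (le_of_eq ?_)
    simp_rw [Finset.sum_add_distrib, ← Finset.mul_sum]
    rw [sq (∑ m ∈ S, ‖α m‖), Finset.sum_mul_sum]
    congr 1
    · rw [Finset.mul_sum]
      refine Finset.sum_congr rfl fun m hm => ?_
      simp [hm]
    · simp_rw [Finset.mul_sum]
  have hcs : (∑ m ∈ S, ‖α m‖) ^ 2 ≤ S.card * ∑ m ∈ S, ‖α m‖ ^ 2 := sq_sum_le_card_mul_sum_sq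
  have hLr : (0 : ℝ) < L := by exact_mod_cast hL0
  have hfin : (L : ℝ) * ∑ i ∈ range L, ‖g (n₀ + i)‖ ^ 2 ≤
      L * ((∑ m ∈ S, ‖α m‖ ^ 2) * (16 * L + 30 * Real.sqrt q * S.card)) := by
    refine hf.trans (hbound.trans ?_)
    have : 30 * L * Real.sqrt q * (∑ m ∈ S, ‖α m‖) ^ 2 ≤
      30 * L * Real.sqrt q * (S.card * ∑ m ∈ S, ‖α m‖ ^ 2) :=
      mul_le_mul_of_nonneg_left hcs (by positivity)
    linarith
  exact le_of_mul_le_mul_left hfin hLr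

lemma bil_core (c : ℕ → ZMod q) (S : Finset ℕ)
    (hS : ∀ m₁ ∈ S, ∀ m₂ ∈ S, m₁ ≠ m₂ → c m₁ ≠ c m₂) (L : ℕ) (hL0 : 0 < L) (hL : 2 * L ≤ 4 * q)
    (n₀ : ZMod q) (α : ℕ → ℂ) (β : ℕ → ℂ) :
    ‖∑ m ∈ S, ∑ i ∈ range L, α m * β i * Kl q (c m * (n₀ + i))‖ ^ 2 ≤
      (∑ m ∈ S, ‖α m‖ ^ 2) * (∑ i ∈ range L, ‖β i‖ ^ 2) *
        (16 * L + 30 * Real.sqrt q * S.card) := by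
  have h1 : ∑ m ∈ S, ∑ i ∈ range L, α m * β i * Kl q (c m * (n₀ + i)) =
      ∑ i ∈ range L, β i * ∑ m ∈ S, α m * Kl q (c m * (n₀ + i)) := by
    rw [Finset.sum_comm]
    refine Finset.sum_congr rfl fun i _ => ?_
    rw [Finset.mul_sum]
    exact Finset.sum_congr rfl fun m _ => by ring
  rw [h1]
  have h2 : ‖∑ i ∈ range L, β i * ∑ m ∈ S, α m * Kl q (c m * (n₀ + i))‖ ≤
      ∑ i ∈ range L, ‖β i‖ * ‖∑ m ∈ S, α m * Kl q (c m * (n₀ + i))‖ := by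
    refine (norm_sum_le _ _).trans (le_of_eq ?_)
    exact Finset.sum_congr rfl fun i _ => norm_mul _ _
  have h3 := Finset.sum_mul_sq_le_sq_mul_sq (range L) (fun i => ‖β i‖)
    (fun i => ‖∑ m ∈ S, α m * Kl q (c m * (n₀ + i))‖)
  refine (pow_le_pow_left₀ (norm_nonneg _) h2 2).trans (h3.trans ?_)
  have h4 := bil_g c S hS L hL0 hL n₀ α
  have h5 : 0 ≤ ∑ i ∈ range L, ‖β i‖ ^ 2 := Finset.sum_nonneg fun _ _ => by positivity
  refine (mul_le_mul_of_nonneg_left h4 h5).trans (le_of_eq (by ring))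

end KloostermanBil

/-- Part (1) of Theorem 5.1 (bilinear forms in Kloosterman sums, general coefficients). -/
theorem bilinear_kloosterman_general (ε : ℝ) (hε : 0 < ε) :
    ∃ C : ℝ, 0 < C ∧
      ∀ (q : ℕ) [Fact (Nat.Prime q)] (a : ℤ), IsCoprime a (q : ℤ) →
        ∀ M N : ℝ, 1 ≤ M → M ≤ (q : ℝ) → 1 ≤ N → N ≤ (q : ℝ) →
          ∀ 𝒩 : Set ℝ, (∃ x₀ : ℝ, 𝒩 ⊆ Set.Icc x₀ (x₀ + N)) →
            ∀ α : ℕ → ℂ, (∀ m : ℕ, ¬(1 ≤ m ∧ (m : ℝ) ≤ M) → α m = 0) →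
              ∀ β : ℤ → ℂ, (∀ n : ℤ, (n : ℝ) ∉ 𝒩 → β n = 0) →
                ‖∑' (m : ℕ) (n : ℤ), α m * β n * Kl q (((a * m * n : ℤ) : ZMod q))‖ ≤
                  C * ((q : ℝ) * M * N) ^ ε * (M * N) ^ ((1 : ℝ) / 2) *
                    l2norm α * l2norm β *
                    (M ^ (-(1 : ℝ) / 2) + (q : ℝ) ^ ((1 : ℝ) / 4) * N ^ (-(1 : ℝ) / 2)) := by
  refine ⟨6, by norm_num, ?_⟩
  intro q _ a ha M N hM1 hMq hN1 hNq I hI α hα β hβ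
  obtain ⟨x₀, hx₀⟩ := hI
  have hqp : q.Prime := Fact.out
  have hq1 : (1 : ℝ) ≤ q := by exact_mod_cast hqp.one_lt.le
  have hM0 : 0 < M := by linarith
  have hN0 : 0 < N := by linarith
  have hq0 : (0 : ℝ) < q := by linarith
  set S : Finset ℕ := Finset.Icc 1 ⌊M⌋₊ with hS
  set L : ℕ := ⌊N⌋₊ + 1 with hLdef
  set n₀ : ℤ := ⌈x₀⌉ with hn₀
  have hNfl : (⌊N⌋₊ : ℝ) ≤ N := Nat.floor_le hN0.le
  have hMfl : (⌊M⌋₊ : ℝ) ≤ M := Nat.floor_le hM0.le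
  have hα0 : ∀ m ∉ S, α m = 0 := by
    intro m hm
    apply hα
    rintro ⟨h1, h2⟩
    exact hm (Finset.mem_Icc.2 ⟨h1, Nat.le_floor h2⟩)
  set J : Finset ℤ := Finset.image (fun i : ℕ => n₀ + (i : ℤ)) (Finset.range L) with hJ
  have hinj : Set.InjOn (fun i : ℕ => n₀ + (i : ℤ)) (Finset.range L) := by
    intro i _ j _ h
    simpa using h
  have hβ0 : ∀ n ∉ J, β n = 0 := by
    intro n hn
    apply hβ
    intro h
    have h1 := hx₀ h
    apply hn
    have h2 : n₀ ≤ n := Int.ceil_le.2 h1.1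
    refine Finset.mem_image.2 ⟨(n - n₀).toNat, ?_, ?_⟩
    · rw [Finset.mem_range, hLdef, Nat.lt_succ_iff]
      apply Nat.le_floor
      have h3 : (((n - n₀).toNat : ℤ) : ℝ) = ((n - n₀ : ℤ) : ℝ) := by
        rw [Int.toNat_of_nonneg (by omega)]
      have h4 : (((n - n₀).toNat : ℕ) : ℝ) = ((n - n₀ : ℤ) : ℝ) := by
        rw [← h3]; push_cast; rfl
      rw [h4]
      push_cast
      have h5 : x₀ ≤ n₀ := Int.le_ceil x₀
      linarith [h1.2]
    · omega
  have hsum : (∑' (m : ℕ) (n : ℤ), α m * β n * Kl q (((a * m * n : ℤ) : ZMod q))) =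
      ∑ m ∈ S, ∑ i ∈ Finset.range L, α m * β (n₀ + (i : ℤ)) *
        Kl q (((a : ZMod q) * (m : ZMod q)) * ((n₀ : ZMod q) + (i : ZMod q))) := by
    rw [tsum_eq_sum (s := S)]
    · refine Finset.sum_congr rfl fun m _ => ?_
      rw [tsum_eq_sum (s := J), hJ, Finset.sum_image hinj]
      · refine Finset.sum_congr rfl fun i _ => ?_
        push_cast
        rfl
      · intro n hn
        rw [hβ0 n hn]; simp
    · intro m hm
      simp [hα0 m hm]
  have hA : l2norm α ^ 2 = ∑ m ∈ S, ‖α m‖ ^ 2 := by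
    unfold l2norm
    rw [tsum_eq_sum (s := S) (fun m hm => by simp [hα0 m hm]), Real.sq_sqrt]
    exact Finset.sum_nonneg fun _ _ => by positivity
  have hB : l2norm β ^ 2 = ∑ i ∈ Finset.range L, ‖β (n₀ + (i : ℤ))‖ ^ 2 := by
    unfold l2norm
    rw [tsum_eq_sum (s := J) (fun m hm => by simp [hβ0 m hm]), Real.sq_sqrt, hJ,
      Finset.sum_image hinj]
    exact Finset.sum_nonneg fun _ _ => by positivity
  have ha0 : (a : ZMod q) ≠ 0 := by
    intro h
    rw [ZMod.intCast_zmod_eq_zero_iff_dvd] at h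
    have h1 := ha.isUnit_of_dvd' h dvd_rfl
    rw [Int.isUnit_iff] at h1
    have := hqp.one_lt
    omega
  have hcS : ∀ m₁ ∈ S, ∀ m₂ ∈ S, m₁ ≠ m₂ →
      (a : ZMod q) * (m₁ : ZMod q) ≠ (a : ZMod q) * (m₂ : ZMod q) := by
    intro m₁ h₁ m₂ h₂ hne h
    apply hne
    have h3 := mul_left_cancel₀ ha0 h
    have hfl : ⌊M⌋₊ ≤ q := by exact_mod_cast hMfl.trans hMq
    rw [hS, Finset.mem_Icc] at h₁ h₂
    have h4 := (ZMod.natCast_eq_natCast_iff m₁ m₂ q).1 h3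
    rcases Nat.lt_trichotomy m₁ m₂ with h5 | h5 | h5
    · have h6 := (Nat.modEq_iff_dvd' h5.le).1 h4
      have := Nat.le_of_dvd (by omega) h6
      omega
    · exact h5
    · have h6 := (Nat.modEq_iff_dvd' h5.le).1 h4.symm
      have := Nat.le_of_dvd (by omega) h6
      omega
  have hLq : 2 * L ≤ 4 * q := by
    have h1 : ⌊N⌋₊ ≤ q := by exact_mod_cast hNfl.trans hNq
    have := hqp.one_lt
    omega
  have hcore := bil_core (q := q) (fun m => (a : ZMod q) * (m : ZMod q)) S hcS L (by omega) hLq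
    (n₀ : ZMod q) α (fun i => β (n₀ + (i : ℤ)))
  rw [← hsum, ← hA, ← hB] at hcore
  set T := ‖∑' (m : ℕ) (n : ℤ), α m * β n * Kl q (((a * m * n : ℤ) : ZMod q))‖ with hT
  have hla : 0 ≤ l2norm α := Real.sqrt_nonneg _
  have hlb : 0 ≤ l2norm β := Real.sqrt_nonneg _
  have hLN : (L : ℝ) ≤ 2 * N := by
    rw [hLdef]; push_cast; linarith
  have hSM : (S.card : ℝ) ≤ M := by
    rw [hS, Nat.card_Icc]; simpa using hMfl
  have hE1 : (1 : ℝ) ≤ ((q : ℝ) * M * N) ^ ε := by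
    apply Real.one_le_rpow _ hε.le
    have : 1 ≤ (q : ℝ) * M := by nlinarith
    nlinarith
  set Z := (M * N) ^ ((1 : ℝ) / 2) *
    (M ^ (-(1 : ℝ) / 2) + (q : ℝ) ^ ((1 : ℝ) / 4) * N ^ (-(1 : ℝ) / 2)) with hZ
  have hZeq : Z = N ^ ((1 : ℝ) / 2) + (q : ℝ) ^ ((1 : ℝ) / 4) * M ^ ((1 : ℝ) / 2) := by
    have e1 : M ^ ((1 : ℝ) / 2) * M ^ (-(1 : ℝ) / 2) = 1 := by
      rw [← Real.rpow_add hM0]; norm_num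
    have e2 : N ^ ((1 : ℝ) / 2) * N ^ (-(1 : ℝ) / 2) = 1 := by
      rw [← Real.rpow_add hN0]; norm_num
    rw [hZ, Real.mul_rpow hM0.le hN0.le]
    linear_combination N ^ ((1 : ℝ) / 2) * e1 + (q : ℝ) ^ ((1 : ℝ) / 4) * M ^ ((1 : ℝ) / 2) * e2
  have hN2 : (N ^ ((1 : ℝ) / 2)) ^ 2 = N := by
    rw [← Real.sqrt_eq_rpow, Real.sq_sqrt hN0.le]
  have hM2 : (M ^ ((1 : ℝ) / 2)) ^ 2 = M := by
    rw [← Real.sqrt_eq_rpow, Real.sq_sqrt hM0.le]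
  have hq2 : ((q : ℝ) ^ ((1 : ℝ) / 4)) ^ 2 = Real.sqrt q := by
    rw [Real.sqrt_eq_rpow, ← Real.rpow_natCast, ← Real.rpow_mul hq0.le]
    norm_num
  have hZ0 : 0 ≤ Z := by rw [hZeq]; positivity
  have hZ2 : N + Real.sqrt q * M ≤ Z ^ 2 := by
    have hcr : 0 ≤ N ^ ((1 : ℝ) / 2) * ((q : ℝ) ^ ((1 : ℝ) / 4) * M ^ ((1 : ℝ) / 2)) := by
      positivity
    rw [hZeq, add_sq, mul_pow, hN2, hM2, hq2]
    linarith
  have hfac : 16 * (L : ℝ) + 30 * Real.sqrt q * S.card ≤ 36 * Z ^ 2 := by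
    have h1 : Real.sqrt q * S.card ≤ Real.sqrt q * M :=
      mul_le_mul_of_nonneg_left hSM (Real.sqrt_nonneg _)
    have h2 : 0 ≤ Real.sqrt q * M := by positivity
    linarith
  have hsq : T ^ 2 ≤ (6 * (l2norm α * l2norm β * Z)) ^ 2 := by
    have h1 : 0 ≤ l2norm α ^ 2 * l2norm β ^ 2 := by positivity
    refine hcore.trans ((mul_le_mul_of_nonneg_left hfac h1).trans (le_of_eq (by ring)))
  have hprod : 0 ≤ l2norm α * l2norm β * Z := by positivity
  have hT6 : T ≤ 6 * (l2norm α * l2norm β * Z) :=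
    (abs_le_of_sq_le_sq' hsq (by positivity)).2
  refine hT6.trans ?_
  have h7 := mul_le_mul_of_nonneg_right hE1 (mul_nonneg (by norm_num : (0 : ℝ) ≤ 6) hprod)
  rw [one_mul] at h7
  refine h7.trans (le_of_eq ?_)
  rw [hZ]
  ring
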